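/- arXiv:1101.1508 — 6 statements merged into one kernel-verified Lean document; each statement's English description precedes it below -/
import Mathlib

section
/- Let f, g : K → K. Then C_f = C_g if and only if g = A_1 ∘ f + A for some affine permutation A_1 of K and some affine map A : K → K. -/
/-- The code `C_f` associated to a function `f : K → K`. -/
def code {K : Type*} [Field K] [Algebra (ZMod 2) K] (f : K → K) : Set (K → ZMod 2) :=
  {c | ∃ (α β : K) (ε : ZMod 2),
    c = fun x => Algebra.trace (ZMod 2) K (α * x) + Algebra.trace (ZMod 2) K (β * f x) + ε}

/-- An affine map `K → K`: a map of the form `x ↦ L(x) + t` with `L` an `F₂`-linear map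
and `t ∈ K`. -/
def IsAffineMap {K : Type*} [Field K] [Algebra (ZMod 2) K] (A : K → K) : Prop :=
  ∃ (L : K →ₗ[ZMod 2] K) (t : K), ∀ x, A x = L x + t

/-- Two linear maps on a finite-dimensional space with the same range differ by an
automorphism of the source. -/
theorem LinearMap.exists_linearEquiv_comp_eq_of_range_eq {k V W : Type*} [Field k]
    [AddCommGroup V] [Module k V] [FiniteDimensional k V] [AddCommGroup W] [Module k W]
    (φ ψ : V →ₗ[k] W) (h : LinearMap.range φ = LinearMap.range ψ) :
    ∃ e : V ≃ₗ[k] V, ∀ v, φ (e v) = ψ v := by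
  obtain ⟨C, hC⟩ := Submodule.exists_isCompl (LinearMap.ker φ)
  obtain ⟨D, hD⟩ := Submodule.exists_isCompl (LinearMap.ker ψ)
  have hker : Module.finrank k (LinearMap.ker ψ) = Module.finrank k (LinearMap.ker φ) := by
    have h₁ := φ.finrank_range_add_finrank_ker
    have h₂ := ψ.finrank_range_add_finrank_ker
    rw [h] at h₁
    omega
  let e₁ := LinearEquiv.ofFinrankEq (LinearMap.ker ψ) (LinearMap.ker φ) hker
  let e₂ : D ≃ₗ[k] C := ψ.kerComplementEquivRange hD.symm ≪≫ₗ
    LinearEquiv.ofEq _ _ h.symm ≪≫ₗ (φ.kerComplementEquivRange hC.symm).symm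
  have he₂ : ∀ d : D, φ (e₂ d) = ψ d := fun d =>
    congrArg Subtype.val ((φ.kerComplementEquivRange hC.symm).apply_symm_apply
      (LinearEquiv.ofEq _ _ h.symm (ψ.kerComplementEquivRange hD.symm d)))
  refine ⟨(Submodule.prodEquivOfIsCompl _ _ hD).symm ≪≫ₗ e₁.prodCongr e₂ ≪≫ₗ
    Submodule.prodEquivOfIsCompl _ _ hC, fun v => ?_⟩
  obtain ⟨⟨a, d⟩, rfl⟩ := (Submodule.prodEquivOfIsCompl _ _ hD).surjective v
  have h₁ : φ (e₁ a) = 0 := (e₁ a).2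
  have h₂ : ψ a = 0 := a.2
  simp [h₁, h₂, he₂]

/-- The subspace of functions `c : V → k` satisfying `c (x + y) + c 0 = c x + c y`. -/
def affineFunctions (k V : Type*) [Field k] [AddCommGroup V] : Submodule k (V → k) where
  carrier := {c | ∀ x y, c (x + y) + c 0 = c x + c y}
  zero_mem' := by simp
  add_mem' {a b} ha hb x y := by
    have h₁ := ha x y
    have h₂ := hb x y
    simp only [Pi.add_apply]
    linear_combination h₁ + h₂
  smul_mem' r a ha x y := by
    have h₁ := ha x y
    simp only [Pi.smul_apply, smul_eq_mul]
    linear_combination r * h₁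

section Code

variable {K : Type*} [Field K] [Algebra (ZMod 2) K]

/-- The component functions of `f`, modulo affine functions. -/
noncomputable def componentsModAffine (f : K → K) :
    K →ₗ[ZMod 2] (K → ZMod 2) ⧸ affineFunctions (ZMod 2) K :=
  (affineFunctions (ZMod 2) K).mkQ ∘ₗ
    LinearMap.pi fun x => (Algebra.traceForm (ZMod 2) K).flip (f x)

theorem componentsModAffine_eq_iff (f g : K → K) (β γ : K) :
    componentsModAffine f β = componentsModAffine g γ ↔
      (fun x => Algebra.trace (ZMod 2) K (β * f x) - Algebra.trace (ZMod 2) K (γ * g x)) ∈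
        affineFunctions (ZMod 2) K :=
  Submodule.Quotient.eq _

theorem range_componentsModAffine_le {f g : K → K} (h : code f ⊆ code g) :
    LinearMap.range (componentsModAffine f) ≤ LinearMap.range (componentsModAffine g) := by
  rintro _ ⟨β, rfl⟩
  obtain ⟨α, γ, ε, hc⟩ := h ⟨0, β, 0, rfl⟩
  refine ⟨γ, ((componentsModAffine_eq_iff f g β γ).2 fun x y => ?_).symm⟩
  have key : ∀ x, Algebra.trace (ZMod 2) K (β * f x) - Algebra.trace (ZMod 2) K (γ * g x) =
      Algebra.trace (ZMod 2) K (α * x) + ε := fun x => by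
    have := congrFun hc x
    simp only [zero_mul, map_zero, zero_add, add_zero] at this
    rw [this]
    ring
  simp only [key, mul_add, map_add, mul_zero, map_zero]
  ring

variable [Fintype K]

theorem exists_trace_adjoint (L : K →ₗ[ZMod 2] K) :
    ∃ M : K →ₗ[ZMod 2] K, ∀ x y,
      Algebra.trace (ZMod 2) K (M x * y) = Algebra.trace (ZMod 2) K (x * L y) :=
  ⟨_, (Algebra.traceForm (ZMod 2) K).isAdjointPairLeftAdjointOfNondegenerate
    (traceForm_nondegenerate _ _) L⟩

theorem eq_of_forall_trace_mul_eq {a b : K}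
    (h : ∀ β, Algebra.trace (ZMod 2) K (β * a) = Algebra.trace (ZMod 2) K (β * b)) : a = b := by
  rw [← sub_eq_zero]
  refine (traceForm_nondegenerate (ZMod 2) K).2 _ fun β => ?_
  rw [Algebra.traceForm_apply, mul_sub, map_sub, h, sub_self]

theorem code_subset_of_eq {f g : K → K} (L A : K →ₗ[ZMod 2] K) (t : K)
    (h : ∀ x, g x = L (f x) + A x + t) : code g ⊆ code f := by
  rintro _ ⟨α, β, ε, rfl⟩
  obtain ⟨L', hL'⟩ := exists_trace_adjoint L
  obtain ⟨A', hA'⟩ := exists_trace_adjoint A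
  refine ⟨α + A' β, L' β, Algebra.trace (ZMod 2) K (β * t) + ε, funext fun x => ?_⟩
  simp only [h, mul_add, add_mul, map_add, hL', hA']
  ring

theorem isAffineMap_of_forall_trace_mul_mem {h : K → K}
    (hh : ∀ β, (fun x => Algebra.trace (ZMod 2) K (β * h x)) ∈ affineFunctions (ZMod 2) K) :
    IsAffineMap h := by
  have key : ∀ x y, h (x + y) + h 0 = h x + h y := fun x y =>
    eq_of_forall_trace_mul_eq fun β => by simpa [mul_add] using hh β x y
  refine ⟨(AddMonoidHom.mk' (fun x => h x - h 0) fun x y => ?_).toZModLinearMap 2, h 0,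
    fun x => by simp⟩
  linear_combination key x y

end Code

/-- `C_f = C_g` if and only if `g = A₁ ∘ f + A` for some affine permutation `A₁` of `K` and
some affine map `A : K → K`. -/
theorem stmt2 {K : Type*} [Field K] [Fintype K] [Algebra (ZMod 2) K]
    (n : ℕ) (hn : 1 ≤ n) (hcard : Fintype.card K = 2 ^ n)
    (f g : K → K) :
    code f = code g ↔
      ∃ A₁ A : K → K, IsAffineMap A₁ ∧ Function.Bijective A₁ ∧ IsAffineMap A ∧
        ∀ x, g x = A₁ (f x) + A x := by
  constructor
  · intro h
    obtain ⟨e, he⟩ := LinearMap.exists_linearEquiv_comp_eq_of_range_eq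
      (componentsModAffine f) (componentsModAffine g)
      (le_antisymm (range_componentsModAffine_le h.le) (range_componentsModAffine_le h.ge))
    obtain ⟨M, hM⟩ := exists_trace_adjoint (e : K →ₗ[ZMod 2] K)
    have hM' : ∀ β y, Algebra.trace (ZMod 2) K (β * M y) =
        Algebra.trace (ZMod 2) K (e β * y) := fun β y => by
      rw [mul_comm, hM, mul_comm, LinearEquiv.coe_coe]
    have hinj : Function.Injective M := fun a b hab => eq_of_forall_trace_mul_eq fun β => by
      rw [← e.apply_symm_apply β, ← hM', ← hM', hab]
    refine ⟨M, fun x => g x - M (f x), ⟨M, 0, by simp⟩, Finite.injective_iff_bijective.1 hinj,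
      isAffineMap_of_forall_trace_mul_mem fun β => ?_, fun x => by ring⟩
    simpa only [mul_sub, map_sub, hM'] using
      (componentsModAffine_eq_iff g f β (e β)).1 (he β).symm
  · rintro ⟨A₁, A, ⟨L, t, hL⟩, hbij, ⟨A', s, hA⟩, hg⟩
    have hLbij : Function.Bijective L := by
      refine Finite.injective_iff_bijective.1 fun a b hab => hbij.1 ?_
      rw [hL, hL, hab]
    let e := LinearEquiv.ofBijective L hLbij
    have hg' : ∀ x, g x = L (f x) + A' x + (t + s) := fun x => by
      rw [hg, hL, hA]
      ring
    refine Set.Subset.antisymm ?_ (code_subset_of_eq L A' (t + s) hg')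
    refine code_subset_of_eq e.symm (-(e.symm : K →ₗ[ZMod 2] K) ∘ₗ A') (-e.symm (t + s))
      fun x => ?_
    have he : e.symm (L (f x)) = f x := e.symm_apply_apply (f x)
    rw [hg']
    simp [he]
    ring
end

section
/- Let C_0 = { x ↦ Tr(α x) + ε : α ∈ K, ε ∈ F_2 } be the first-order Reed–Muller code inside F_2^K. An F_2-linear subspace C of F_2^K satisfies C_0 ⊆ C and dim_{F_2} C ≤ 2n + 1 if and only if C = C_f for some function f : K → K. -/
/-- The first-order Reed–Muller code `C₀ = { x ↦ Tr(α x) + ε }` inside `F₂^K`. -/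
def rmCode (K : Type*) [Field K] [Algebra (ZMod 2) K] : Set (K → ZMod 2) :=
  {c | ∃ (α : K) (ε : ZMod 2), c = fun x => Algebra.trace (ZMod 2) K (α * x) + ε}

/-- The linear map `K → F₂^K` sending `β` to `x ↦ Tr(β f(x))`. -/
noncomputable def traceComp {K : Type*} [Field K] [Algebra (ZMod 2) K] (f : K → K) :
    K →ₗ[ZMod 2] (K → ZMod 2) :=
  LinearMap.pi fun x => (Algebra.trace (ZMod 2) K).comp (LinearMap.mulRight (ZMod 2) (f x))

/-- The parametrization `(α, ε) ↦ (x ↦ Tr(α x) + ε)` of the first-order Reed–Muller code. -/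
noncomputable def rmMap (K : Type*) [Field K] [Algebra (ZMod 2) K] :
    (K × ZMod 2) →ₗ[ZMod 2] (K → ZMod 2) :=
  (traceComp id).coprod (LinearMap.pi fun _ => LinearMap.id)

theorem coe_range_rmMap (K : Type*) [Field K] [Algebra (ZMod 2) K] :
    (LinearMap.range (rmMap K) : Set (K → ZMod 2)) = rmCode K := by
  ext c
  constructor
  · rintro ⟨⟨α, ε⟩, rfl⟩
    exact ⟨α, ε, rfl⟩
  · rintro ⟨α, ε, rfl⟩
    exact ⟨⟨α, ε⟩, rfl⟩

theorem code_eq_coe_sup {K : Type*} [Field K] [Algebra (ZMod 2) K] (f : K → K) :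
    code f = (LinearMap.range (rmMap K) ⊔ LinearMap.range (traceComp f) :
      Submodule (ZMod 2) (K → ZMod 2)) := by
  ext c
  rw [SetLike.mem_coe, Submodule.mem_sup]
  constructor
  · rintro ⟨α, β, ε, rfl⟩
    refine ⟨_, ⟨⟨α, ε⟩, rfl⟩, _, ⟨β, rfl⟩, ?_⟩
    ext x
    exact add_right_comm _ _ _
  · rintro ⟨_, ⟨⟨α, ε⟩, rfl⟩, _, ⟨β, rfl⟩, rfl⟩
    refine ⟨α, β, ε, ?_⟩
    ext x
    exact add_right_comm _ _ _

theorem finrank_of_card_eq_two_pow {K : Type*} [Field K] [Fintype K] [Algebra (ZMod 2) K]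
    {n : ℕ} (hcard : Fintype.card K = 2 ^ n) : Module.finrank (ZMod 2) K = n := by
  have h := Module.card_eq_pow_finrank (K := ZMod 2) (V := K)
  rw [hcard, ZMod.card] at h
  exact (Nat.pow_right_injective le_rfl h).symm

theorem rmMap_injective (K : Type*) [Field K] [Fintype K] [Algebra (ZMod 2) K] :
    Function.Injective (rmMap K) := by
  rw [injective_iff_map_eq_zero]
  rintro ⟨α, ε⟩ h
  have h' : ∀ x, Algebra.trace (ZMod 2) K (α * x) + ε = 0 := fun x => congrFun h x
  have hε : ε = 0 := by simpa using h' 0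
  subst hε
  have hα : α = 0 := (traceForm_nondegenerate (ZMod 2) K).1 α fun x => by
    simpa [Algebra.traceForm_apply] using h' x
  rw [hα]
  rfl

/-- Every linear map `K → F₂^K` is of the form `β ↦ (x ↦ Tr(β f(x)))`. -/
theorem exists_traceComp_eq {K : Type*} [Field K] [Fintype K] [Algebra (ZMod 2) K]
    (g : K →ₗ[ZMod 2] (K → ZMod 2)) : ∃ f : K → K, traceComp f = g := by
  have key (x : K) : ∃ y : K, ∀ β, Algebra.trace (ZMod 2) K (β * y) = g β x := by
    refine ⟨((Algebra.traceForm (ZMod 2) K).toDual (traceForm_nondegenerate (ZMod 2) K)).symm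
      ((LinearMap.proj x).comp g), fun β => ?_⟩
    rw [mul_comm, ← Algebra.traceForm_apply, LinearMap.BilinForm.apply_toDual_symm_apply]
    rfl
  choose f hf using key
  exact ⟨f, by ext β x; exact hf x β⟩

/-- A subspace of dimension at most `dim V` is the range of a linear map from `V`. -/
theorem exists_range_eq_of_finrank_le {k V W : Type*} [Field k] [AddCommGroup V] [Module k V]
    [AddCommGroup W] [Module k W] [FiniteDimensional k V] [FiniteDimensional k W]
    (D : Submodule k W) (h : Module.finrank k D ≤ Module.finrank k V) :
    ∃ g : V →ₗ[k] W, LinearMap.range g = D := by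
  obtain ⟨i, hi⟩ := finrank_le_iff_exists_linearMap.1 h
  obtain ⟨p, hp⟩ := i.exists_leftInverse_of_injective (LinearMap.ker_eq_bot.2 hi)
  have hsurj : Function.Surjective p := fun d => ⟨i d, LinearMap.congr_fun hp d⟩
  exact ⟨D.subtype.comp p, by
    rw [LinearMap.range_comp_of_range_eq_top _ (LinearMap.range_eq_top.2 hsurj),
      Submodule.range_subtype]⟩

/-- An `F₂`-linear subspace `C` of `F₂^K` satisfies `C₀ ⊆ C` and `dim C ≤ 2n + 1` if and
only if `C = C_f` for some function `f : K → K`. -/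
theorem stmt3 {K : Type*} [Field K] [Fintype K] [Algebra (ZMod 2) K]
    (n : ℕ) (hn : 1 ≤ n) (hcard : Fintype.card K = 2 ^ n)
    (C : Submodule (ZMod 2) (K → ZMod 2)) :
    (rmCode K ⊆ (C : Set (K → ZMod 2)) ∧ Module.finrank (ZMod 2) C ≤ 2 * n + 1) ↔
      ∃ f : K → K, (C : Set (K → ZMod 2)) = code f := by
  have hK := finrank_of_card_eq_two_pow hcard
  have hR : Module.finrank (ZMod 2) (LinearMap.range (rmMap K)) = n + 1 := by
    rw [LinearMap.finrank_range_of_inj (rmMap_injective K), Module.finrank_prod, hK,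
      Module.finrank_self]
  simp only [← coe_range_rmMap, code_eq_coe_sup, SetLike.coe_subset_coe, SetLike.coe_set_eq]
  constructor
  · rintro ⟨hle, hdim⟩
    obtain ⟨E, hE⟩ := (LinearMap.range (rmMap K)).exists_isCompl
    have hsup : LinearMap.range (rmMap K) ⊔ E ⊓ C = C := by
      rw [← sup_inf_assoc_of_le E hle, hE.sup_eq_top, top_inf_eq]
    have hinf : LinearMap.range (rmMap K) ⊓ (E ⊓ C) = ⊥ := by
      rw [← inf_assoc, hE.inf_eq_bot, bot_inf_eq]
    have hadd := Submodule.finrank_sup_add_finrank_inf_eq (LinearMap.range (rmMap K)) (E ⊓ C)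
    rw [hsup, hinf, finrank_bot, hR] at hadd
    obtain ⟨g, hg⟩ := exists_range_eq_of_finrank_le (V := K) (E ⊓ C) (by omega)
    obtain ⟨f, rfl⟩ := exists_traceComp_eq g
    exact ⟨f, by rw [hg, hsup]⟩
  · rintro ⟨f, rfl⟩
    refine ⟨le_sup_left, ?_⟩
    have hadd := Submodule.finrank_add_le_finrank_add_finrank (LinearMap.range (rmMap K))
      (LinearMap.range (traceComp f))
    have hT := LinearMap.finrank_range_le (traceComp f)
    omega
end

section
/- Let f : K → K be a quadratic APN function and let g : K → K be a Gold function g(x) = x^{2^r+1} with gcd(r,n) = 1. If f and g are CCZ-equivalent (i.e., σ(C_f) = C_g for some permutation σ of K), then f and g are EA-equivalent. -/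
/-- `f` is APN: for all `a ≠ 0` and all `b`, the equation `f(x+a) + f(x) = b` has at most
two solutions. -/
def IsAPN {K : Type*} [Field K] (f : K → K) : Prop :=
  ∀ a b : K, a ≠ 0 → ({x : K | f (x + a) + f x = b}).ncard ≤ 2

/-- EA-equivalence of functions `K → K`. -/
def EAEquiv {K : Type*} [Field K] [Algebra (ZMod 2) K] (f g : K → K) : Prop :=
  ∃ A₁ A₂ A : K → K, IsAffineMap A₁ ∧ Function.Bijective A₁ ∧
    IsAffineMap A₂ ∧ Function.Bijective A₂ ∧ IsAffineMap A ∧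
    ∀ x, g x = A₁ (f (A₂ x)) + A x

/-- In a finite group, a conjugation-invariant family of `p`-subgroups in which any two mutually
normalizing members coincide consists of conjugate subgroups. -/
theorem exists_conj_of_mutually_normalizing_eq {G : Type*} [Group G] [Finite G] (p : ℕ)
    [Fact p.Prime] (P : Subgroup G → Prop)
    (hconj : ∀ H (t : G), P H → P (H.map (MulAut.conj t).toMonoidHom))
    (hp : ∀ H, P H → IsPGroup p H)
    (huniq : ∀ H H' : Subgroup G, P H → P H' → H ≤ Subgroup.normalizer (H' : Set G) →
      H' ≤ Subgroup.normalizer (H : Set G) → H = H')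
    {H H' : Subgroup G} (hH : P H) (hH' : P H') :
    ∃ t : G, H' = H.map (MulAut.conj t).toMonoidHom := by
  have hmem : ∀ (H : Subgroup G) (t x : G),
      x ∈ H.map (MulAut.conj t).toMonoidHom ↔ t⁻¹ * x * t ∈ H := by
    intro H t x
    constructor
    · rintro ⟨y, hy, rfl⟩
      simpa [mul_assoc] using hy
    · intro hx
      exact ⟨_, hx, by simp [mul_assoc]⟩
  have hnormal : ∀ (S : Sylow p G) (H : Subgroup G), P H → H ≤ S →
      (S : Subgroup G) ≤ Subgroup.normalizer (H : Set G) := by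
    intro S H hH hHS
    by_contra hcon
    set N : Subgroup S := (Subgroup.normalizer (H : Set G)).subgroupOf S with hN
    have hNtop : N < ⊤ := by
      rw [lt_top_iff_ne_top]
      intro h
      exact hcon (Subgroup.subgroupOf_eq_top.mp h)
    have : Group.IsNilpotent S := S.isPGroup'.isNilpotent
    have hlt := Group.normalizerCondition_of_isNilpotent N hNtop
    obtain ⟨s, hs, hsN⟩ := SetLike.exists_of_lt hlt
    have hsN' : (s : G) ∉ Subgroup.normalizer (H : Set G) := by
      simpa [hN, Subgroup.mem_subgroupOf] using hsN
    have hs1 : ∀ x : G, x ∈ S →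
        (x ∈ Subgroup.normalizer (H : Set G) ↔ s * x * s⁻¹ ∈ Subgroup.normalizer (H : Set G)) := by
      intro x hx
      have := Subgroup.mem_normalizer_iff.mp hs ⟨x, hx⟩
      simpa [hN, Subgroup.mem_subgroupOf] using this
    have hHN : H ≤ Subgroup.normalizer (H : Set G) := Subgroup.le_normalizer
    have hconjN : H.map (MulAut.conj (s : G)).toMonoidHom ≤
        Subgroup.normalizer (H : Set G) := by
      rintro _ ⟨y, hy, rfl⟩
      exact (hs1 y (hHS hy)).mp (hHN hy)
    have hN' : H ≤ Subgroup.normalizer (H.map (MulAut.conj (s : G)).toMonoidHom : Set G) := by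
      intro x hx
      have hy : (s : G)⁻¹ * x * s ∈ Subgroup.normalizer (H : Set G) := by
        refine (hs1 _ (S.mul_mem (S.mul_mem (S.inv_mem s.2) (hHS hx)) s.2)).mpr ?_
        simpa [mul_assoc] using hHN hx
      rw [Subgroup.mem_normalizer_iff] at hy ⊢
      intro z
      rw [hmem, hmem, hy]
      simp [mul_assoc]
    have heq := huniq _ _ hH (hconj H s hH) hN' hconjN
    apply hsN'
    rw [Subgroup.mem_normalizer_iff]
    intro z
    conv_rhs => rw [heq]
    rw [hmem]
    simp [mul_assoc]
  obtain ⟨S, hS⟩ := (hp H hH).exists_le_sylow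
  obtain ⟨S', hS'⟩ := (hp H' hH').exists_le_sylow
  obtain ⟨t, ht⟩ := MulAction.exists_smul_eq G S S'
  have hle : H.map (MulAut.conj t).toMonoidHom ≤ S' := by
    rw [← ht]
    rintro _ ⟨y, hy, rfl⟩
    exact ⟨y, hS hy, rfl⟩
  exact ⟨t, (huniq _ _ (hconj H t hH) hH' (hle.trans (hnormal S' _ hH' hS'))
    (hS'.trans (hnormal S' _ (hconj H t hH) hle))).symm⟩

/-- All differences of `f` are affine, normalized so that `f 0 = 0`. -/
def IsQuadraticFun {K : Type*} [Field K] [Algebra (ZMod 2) K] (f : K → K) : Prop :=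
  ∀ a : K, IsLinearMap (ZMod 2) fun x => f (x + a) + f x + f a

/-- The polar form of `f`. -/
def polarForm {K : Type*} [Field K] (f : K → K) (x y : K) : K := f (x + y) + f x + f y

theorem charP_two_of_algebra_zmod (K : Type*) [Field K] [Algebra (ZMod 2) K] : CharP K 2 :=
  charP_of_injective_algebraMap (algebraMap (ZMod 2) K).injective 2

theorem polarForm_comm {K : Type*} [Field K] (f : K → K) (x y : K) :
    polarForm f x y = polarForm f y x := by
  simp only [polarForm, add_comm x y]; ring

namespace IsQuadraticFun

variable {K : Type*} [Field K] [Algebra (ZMod 2) K] {f : K → K}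

/-- The polar form of a quadratic function as a linear map in its second argument. -/
def polarLin (hf : IsQuadraticFun f) (a : K) : K →ₗ[ZMod 2] K := (hf a).mk'

theorem polarLin_apply (hf : IsQuadraticFun f) (a x : K) :
    hf.polarLin a x = polarForm f a x := by
  rw [polarForm_comm]; rfl

theorem polarForm_add_right (hf : IsQuadraticFun f) (a x y : K) :
    polarForm f a (x + y) = polarForm f a x + polarForm f a y := by
  simp only [← hf.polarLin_apply, map_add]

theorem polarForm_add_left (hf : IsQuadraticFun f) (x y a : K) :
    polarForm f (x + y) a = polarForm f x a + polarForm f y a := by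
  simp only [polarForm_comm f _ a, hf.polarForm_add_right]

theorem polarForm_zero_right (hf : IsQuadraticFun f) (a : K) : polarForm f a 0 = 0 := by
  simp only [← hf.polarLin_apply, map_zero]

theorem polarForm_zero_left (hf : IsQuadraticFun f) (a : K) : polarForm f 0 a = 0 := by
  rw [polarForm_comm, hf.polarForm_zero_right]

theorem map_zero (hf : IsQuadraticFun f) : f 0 = 0 := by
  have := charP_two_of_algebra_zmod K
  have := hf.polarForm_zero_left 0
  simp only [polarForm, add_zero] at this
  grind

theorem polarForm_self (hf : IsQuadraticFun f) (a : K) : polarForm f a a = 0 := by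
  have := charP_two_of_algebra_zmod K
  have := hf.map_zero
  simp only [polarForm, CharTwo.add_self_eq_zero]
  grind

theorem eq_zero_or_eq_of_polarForm_eq_zero [Finite K] (hf : IsQuadraticFun f) (hapn : IsAPN f)
    {a x : K} (ha : a ≠ 0) (h : polarForm f a x = 0) : x = 0 ∨ x = a := by
  have := charP_two_of_algebra_zmod K
  have h0 := hf.map_zero
  by_contra! hcon
  have hsub : ({0, a, x} : Set K) ⊆ {x : K | f (x + a) + f x = f a} := by
    rintro y (rfl | rfl | rfl)
    · simp [h0]
    · simp [h0, CharTwo.add_self_eq_zero]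
    · simp only [polarForm, add_comm a] at h
      simp only [Set.mem_ofPred_eq]
      grind
  have h3 : ({0, a, x} : Set K).ncard = 3 :=
    Set.ncard_eq_three.mpr ⟨0, a, x, ha.symm, hcon.1.symm, hcon.2.symm, rfl⟩
  have := Set.ncard_le_ncard hsub (Set.toFinite _)
  have := hapn a (f a) ha
  omega

end IsQuadraticFun

/-- The permutation `s` is induced by an affine map sending the graph of `g` into that of `f`. -/
def IsGraphMap {K : Type*} [Field K] [Algebra (ZMod 2) K] (s : Equiv.Perm K) (f g : K → K) :
    Prop :=
  ∃ (L : K × K →ₗ[ZMod 2] K × K) (w : K × K), ∀ x, (s x, f (s x)) = L (x, g x) + w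

/-- The permutation `s` and its inverse are induced by affine maps between the graphs. -/
def IsGraphEquiv {K : Type*} [Field K] [Algebra (ZMod 2) K] (s : Equiv.Perm K) (f g : K → K) :
    Prop :=
  IsGraphMap s f g ∧ IsGraphMap s⁻¹ g f

section GraphEquiv

variable {K : Type*} [Field K] [Algebra (ZMod 2) K] {f g h : K → K} {s t : Equiv.Perm K}

theorem IsGraphMap.mul (hs : IsGraphMap s f g) (ht : IsGraphMap t g h) :
    IsGraphMap (s * t) f h := by
  obtain ⟨L, w, hL⟩ := hs
  obtain ⟨M, u, hM⟩ := ht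
  refine ⟨L ∘ₗ M, L u + w, fun x => ?_⟩
  rw [Equiv.Perm.mul_apply, hL, hM, LinearMap.comp_apply, map_add, add_assoc]

theorem IsGraphEquiv.mul (hs : IsGraphEquiv s f g) (ht : IsGraphEquiv t g h) :
    IsGraphEquiv (s * t) f h :=
  ⟨hs.1.mul ht.1, by rw [mul_inv_rev]; exact ht.2.mul hs.2⟩

theorem IsGraphEquiv.inv (hs : IsGraphEquiv s f g) : IsGraphEquiv s⁻¹ g f :=
  ⟨hs.2, by rw [inv_inv]; exact hs.1⟩

theorem IsGraphEquiv.refl (f : K → K) : IsGraphEquiv 1 f f := by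
  constructor <;> exact ⟨LinearMap.id, 0, fun x => by simp⟩

theorem IsQuadraticFun.isGraphEquiv_addRight (hf : IsQuadraticFun f) (a : K) :
    IsGraphEquiv (Equiv.addRight a) f f := by
  have := charP_two_of_algebra_zmod K
  have key : ∀ a, IsGraphMap (Equiv.addRight a) f f := by
    intro a
    refine ⟨LinearMap.prod (LinearMap.fst _ _ _)
      (LinearMap.snd _ _ _ + hf.polarLin a ∘ₗ LinearMap.fst _ _ _), (a, f a), fun x => ?_⟩
    ext
    · simp
    · have h1 := hf.polarLin_apply a x
      simp only [polarForm, add_comm a x] at h1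
      simp [h1]
      grind
  refine ⟨key a, ?_⟩
  have : (Equiv.addRight a)⁻¹ = Equiv.addRight (-a) := by
    ext x; simp [Equiv.Perm.inv_def]
  rw [this]
  exact key _

theorem IsGraphMap.exists_snd (hs : IsGraphMap s f g) :
    ∃ (M R : K →ₗ[ZMod 2] K) (v : K), ∀ x, f (s x) = M (g x) + R x + v := by
  obtain ⟨L, w, hL⟩ := hs
  refine ⟨LinearMap.snd _ _ _ ∘ₗ L ∘ₗ LinearMap.inr _ _ _,
    LinearMap.snd _ _ _ ∘ₗ L ∘ₗ LinearMap.inl _ _ _, w.2, fun x => ?_⟩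
  have h1 := congrArg Prod.snd (hL x)
  have h2 : (x, g x) = (0, g x) + (x, 0) := by simp
  rw [h2, map_add] at h1
  simpa using h1

end GraphEquiv

section MutuallyNormalizing

variable {K : Type*} [Field K] [Algebra (ZMod 2) K] [Finite K]

/-- A linear map which kills a hyperplane `B(ρ, K)` cannot agree with `B(ρ, ·)` on a
hyperplane. -/
theorem IsQuadraticFun.finrank_le_three_of_agree {h : K → K} (hq : IsQuadraticFun h)
    (hapn : IsAPN h) {ρ b : K} (hρ : ρ ≠ 0) (N ψ : K →ₗ[ZMod 2] K)
    (hψ : ∀ x, ψ x = 0 ∨ ψ x = ρ) (hN : ∀ x, N (polarForm h ρ x) = 0)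
    (hNb : ∀ y, ψ y = 0 → N (polarForm h b y) = polarForm h ρ y) :
    Module.finrank (ZMod 2) K ≤ 3 := by
  have hspan : ∀ W : Submodule (ZMod 2) K, (∀ x ∈ W, x = 0 ∨ x = ρ) →
      Module.finrank (ZMod 2) W ≤ 1 := by
    intro W hW
    have hle : W ≤ Submodule.span (ZMod 2) {ρ} := by
      intro x hx
      rcases hW x hx with rfl | rfl
      · exact zero_mem _
      · exact Submodule.mem_span_singleton_self _
    exact (Submodule.finrank_mono hle).trans (finrank_span_le_card _ |>.trans (by simp))
  have h1 : Module.finrank (ZMod 2) (LinearMap.range ψ) ≤ 1 :=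
    hspan _ (by rintro _ ⟨x, rfl⟩; exact hψ x)
  have h2 := LinearMap.finrank_range_add_finrank_ker ψ
  have h3 : Module.finrank (ZMod 2) (LinearMap.ker (hq.polarLin ρ)) ≤ 1 := by
    refine hspan _ fun x hx => hq.eq_zero_or_eq_of_polarForm_eq_zero hapn hρ ?_
    rwa [← hq.polarLin_apply]
  have h4 := LinearMap.finrank_range_add_finrank_ker (hq.polarLin ρ)
  have h5 : Module.finrank (ZMod 2) (LinearMap.range (hq.polarLin ρ)) ≤
      Module.finrank (ZMod 2) (LinearMap.ker N) := by
    apply Submodule.finrank_mono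
    rintro _ ⟨x, rfl⟩
    rw [LinearMap.mem_ker, hq.polarLin_apply, hN]
  have h6 := LinearMap.finrank_range_add_finrank_ker N
  set T := (hq.polarLin ρ).domRestrict (LinearMap.ker ψ)
  have h7 := LinearMap.finrank_range_add_finrank_ker T
  have h8 : Module.finrank (ZMod 2) (LinearMap.range T) ≤
      Module.finrank (ZMod 2) (LinearMap.range N) := by
    apply Submodule.finrank_mono
    rintro _ ⟨⟨x, hx⟩, rfl⟩
    refine ⟨polarForm h b x, ?_⟩
    rw [hNb x hx, LinearMap.domRestrict_apply, hq.polarLin_apply]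
  have h9 : Module.finrank (ZMod 2) (LinearMap.ker T) ≤
      Module.finrank (ZMod 2) (LinearMap.ker (hq.polarLin ρ)) := by
    rw [← Submodule.finrank_map_subtype_eq]
    apply Submodule.finrank_mono
    rintro _ ⟨x, hx, rfl⟩
    exact hx
  omega

/-- Let `t a` be the translations of a second quadratic structure on the graph of `h`. If they
normalize, and are normalized by, the translations of `K`, then they are translations of `K`. -/
theorem IsQuadraticFun.isTranslation_of_mutually_normalizing {h h' : K → K}
    (hq : IsQuadraticFun h) (hapn : IsAPN h) (hq' : IsQuadraticFun h') {τ : Equiv.Perm K}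
    (hτ : IsGraphEquiv τ h' h) (hfin : 4 ≤ Module.finrank (ZMod 2) K)
    (t : K → K → K) (ht : ∀ a x, τ (t a x) = τ x + a)
    (hn : ∀ a b, ∃ c, ∀ x, t a (x + b) = t a x + c)
    (hn' : ∀ a b, ∃ c, ∀ x, t a (x + b) + b = t c x) (a : K) :
    ∃ c, ∀ x, t a x = x + c := by
  have := charP_two_of_algebra_zmod K
  have htt : ∀ a b x, t a (t b x) = t (a + b) x := fun a b x =>
    τ.injective (by simp only [ht]; ring)
  have ht0 : ∀ x, t 0 x = x := fun x => τ.injective (by simp only [ht, add_zero])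
  have hsurj : ∀ y, ∃ a, t a 0 = y := fun y => ⟨τ y - τ 0, τ.injective (by simp only [ht]; ring)⟩
  have hinv : ∀ a x, t a (t a x) = x := fun a x => by
    rw [htt, CharTwo.add_self_eq_zero, ht0]
  have hcomm : ∀ a b x, t a (t b x) = t b (t a x) := fun a b x => by rw [htt, htt, add_comm]
  have hψ : ∀ a, ∃ ψ : K →ₗ[ZMod 2] K, ∀ x, t a x = x + ψ x + t a 0 := by
    intro a
    have hadd : ∀ x b, t a (x + b) = t a x + t a b + t a 0 := by
      intro x b
      obtain ⟨c, hc⟩ := hn a b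
      have := hc 0
      rw [zero_add] at this
      rw [hc x]
      grind
    refine ⟨(AddMonoidHom.mk' (fun x => t a x + t a 0 + x) fun x y => ?_).toZModLinearMap 2,
      fun x => ?_⟩
    · rw [hadd]
      grind
    · simp only [AddMonoidHom.coe_toZModLinearMap, AddMonoidHom.mk'_apply]
      grind
  choose ψ hψ using hψ
  have hψsymm : ∀ a b, ψ a (t b 0) = ψ b (t a 0) := by
    intro a b
    have := hcomm a b 0
    rw [hψ a (t b 0), hψ b (t a 0)] at this
    grind
  have hψself : ∀ a, ψ a (t a 0) = 0 := by
    intro a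
    have := hinv a 0
    rw [hψ a (t a 0)] at this
    grind
  have hψψ : ∀ a b d, ψ d (ψ a b) = 0 := by
    intro a b d
    obtain ⟨c, hc⟩ := hn' a b
    have htrans : ∀ y, t (c + a) y = y + ψ a b := by
      intro y
      have h1 := hinv a y
      rw [hψ] at h1
      rw [← htt, ← hc, hψ, map_add]
      grind
    have h2 := hcomm d (c + a) 0
    rw [htrans, htrans, zero_add, hψ] at h2
    grind
  have hM : ∀ a, ∃ (M R : K →ₗ[ZMod 2] K) (v : K), ∀ x, h (t a x) = M (h x) + R x + v := by
    intro a
    obtain ⟨M, R, v, h1⟩ := ((hτ.inv.mul (hq'.isGraphEquiv_addRight a)).mul hτ).1.exists_snd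
    refine ⟨M, R, v, fun x => ?_⟩
    rw [← h1 x]
    congr 1
    apply τ.injective
    simp [ht]
  choose M R v hM using hM
  set N : K → K →ₗ[ZMod 2] K := fun a => M a + LinearMap.id with hNdef
  have hMN : ∀ a x, M a x = x + N a x := by
    intro a x
    simp only [hNdef, LinearMap.add_apply, LinearMap.id_apply]
    grind
  have hpol : ∀ a x y, polarForm h (x + ψ a x) (y + ψ a y) =
      polarForm h x y + N a (polarForm h x y) := by
    intro a x y
    have h1 := hq.polarForm_add_right (x + ψ a x) (y + ψ a y) (t a 0)
    have h2 : polarForm h (x + ψ a x) (y + ψ a y) =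
        h (t a (x + y)) + h (t a x) + h (t a y) + h (t a 0) := by
      rw [hψ a (x + y), hψ a x, hψ a y, map_add,
        show x + y + (ψ a x + ψ a y) + t a 0 = x + ψ a x + (y + ψ a y + t a 0) by ring]
      simp only [polarForm] at h1 ⊢
      grind
    have h0 := hq.map_zero
    rw [h2, hM, hM, hM, hM, h0, ← hMN]
    simp only [polarForm, map_add, _root_.map_zero]
    grind
  have hNN : ∀ a b x y, N a (N b (polarForm h x y)) = 0 := by
    intro a b x y
    obtain ⟨Q, P, w, hQ⟩ := hτ.2.exists_snd
    have hQ' : ∀ z, h z = Q (h' (τ z)) + P (τ z) + w := fun z => by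
      rw [← hQ]; simp
    have hdiff : ∀ z, h (t a (t b z)) + h (t a z) + h (t b z) + h z = Q (polarForm h' a b) := by
      intro z
      have h1 := hq'.polarForm_add_left (τ z) a b
      simp only [polarForm] at h1
      have h2 : polarForm h' a b =
          h' (τ z + b + a) + h' (τ z + a) + h' (τ z + b) + h' (τ z) := by
        rw [add_right_comm]
        simp only [polarForm]
        grind
      rw [h2]
      simp only [hQ', ht, map_add]
      grind
    have haff : ∀ z, N a (N b (h z)) = Q (polarForm h' a b) + N a (R b z) + R a (ψ b z) +
        (N a (v b) + R a (t b 0)) := by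
      intro z
      have h1 := hdiff z
      have h2 : t b z = z + ψ b z + t b 0 := hψ b z
      rw [hM a (t b z), hM a z, hM b z, hMN a (_ + _ + _), hMN a (h z), hMN b (h z), h2] at h1
      simp only [map_add] at h1 ⊢
      grind
    have h0 := haff 0
    have hx := haff x
    have hy := haff y
    have hxy := haff (x + y)
    simp only [_root_.map_zero, hq.map_zero] at h0
    simp only [map_add] at hxy
    simp only [polarForm, map_add]
    grind
  have hiso : ∀ x y, polarForm h (ψ a x) (ψ a y) = 0 := by
    intro x y
    obtain ⟨d, rfl⟩ := hsurj y
    have h1 := hpol a x (t a 0)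
    rw [hψself, add_zero, hq.polarForm_add_left, add_right_inj] at h1
    have h2 := hpol d (ψ a x) (t a 0)
    rw [hψψ, add_zero, hq.polarForm_add_right, add_right_inj] at h2
    rw [hψsymm, h2, h1, hNN]
  by_contra hcon
  have hb : ∃ b, ψ a b ≠ 0 := by
    by_contra! hb
    exact hcon ⟨t a 0, fun x => by rw [hψ, hb, add_zero]⟩
  obtain ⟨b, hb⟩ := hb
  have hdich : ∀ x, ψ a x = 0 ∨ ψ a x = ψ a b := fun x =>
    hq.eq_zero_or_eq_of_polarForm_eq_zero hapn hb (hiso b x)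
  have hle := hq.finrank_le_three_of_agree hapn (b := b) hb (N a) (ψ a) hdich
    (fun x => by
      have h1 := hpol a (ψ a b) x
      rwa [hψψ, add_zero, hq.polarForm_add_right, add_right_inj, hiso, eq_comm] at h1)
    (fun y hy => by
      have h1 := hpol a b y
      rw [hy, add_zero, hq.polarForm_add_left, add_right_inj] at h1
      exact h1.symm)
  omega

end MutuallyNormalizing

section Codes

variable {K : Type*} [Field K] [Algebra (ZMod 2) K] [Finite K]

/-- A map `u : K → K` all of whose components lie in the code of `g` factors affinely through the
graph of `g`. -/
theorem exists_linear_of_trace_mul_mem_code {g u : K → K}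
    (hu : ∀ γ : K, (fun x => Algebra.trace (ZMod 2) K (γ * u x)) ∈ code g) :
    ∃ (P Q : K →ₗ[ZMod 2] K) (w : K), ∀ x, u x = P x + Q (g x) + w := by
  let b := Module.finBasis (ZMod 2) K
  have hnd := traceForm_nondegenerate (ZMod 2) K
  let b' := (Algebra.traceForm (ZMod 2) K).dualBasis hnd b
  have hrep : ∀ x, x = ∑ i, Algebra.trace (ZMod 2) K (b i * x) • b' i := by
    intro x
    conv_lhs => rw [← b'.sum_repr x]
    refine Finset.sum_congr rfl fun i _ => ?_
    rw [LinearMap.BilinForm.dualBasis_repr_apply, Algebra.traceForm_apply, mul_comm]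
  choose α β ε h using fun i => hu (b i)
  let T := Algebra.trace (ZMod 2) K
  refine ⟨∑ i, ((T ∘ₗ LinearMap.mulLeft (ZMod 2) (α i)).smulRight (b' i)),
    ∑ i, ((T ∘ₗ LinearMap.mulLeft (ZMod 2) (β i)).smulRight (b' i)), ∑ i, ε i • b' i,
    fun x => ?_⟩
  rw [hrep (u x)]
  simp only [LinearMap.sum_apply, LinearMap.smulRight_apply, LinearMap.comp_apply,
    LinearMap.mulLeft_apply, ← Finset.sum_add_distrib, ← add_smul]
  exact Finset.sum_congr rfl fun i _ => by rw [congrFun (h i) x]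

theorem isGraphMap_of_comp_mem_code {f g : K → K} {s : Equiv.Perm K}
    (hs : ∀ c ∈ code f, c ∘ s ∈ code g) : IsGraphMap s f g := by
  obtain ⟨P, Q, u, h1⟩ := exists_linear_of_trace_mul_mem_code (g := g) (u := s) fun γ =>
    hs _ ⟨γ, 0, 0, rfl⟩ |> fun h => by simpa [Function.comp_def] using h
  obtain ⟨R, S, v, h2⟩ := exists_linear_of_trace_mul_mem_code (g := g) (u := fun x => f (s x))
    fun γ => hs _ ⟨0, γ, 0, rfl⟩ |> fun h => by simpa [Function.comp_def] using h
  exact ⟨LinearMap.prod (P.coprod Q) (R.coprod S), (u, v), fun x => by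
    simp [h2, ← h1]⟩

theorem isGraphEquiv_of_image_code {f g : K → K} {s : Equiv.Perm K}
    (hs : (fun c : K → ZMod 2 => c ∘ ⇑s) '' code f = code g) : IsGraphEquiv s f g := by
  refine ⟨isGraphMap_of_comp_mem_code fun c hc => hs ▸ ⟨c, hc, rfl⟩,
    isGraphMap_of_comp_mem_code fun c hc => ?_⟩
  rw [← hs] at hc
  obtain ⟨d, hd, rfl⟩ := hc
  have : (d ∘ s) ∘ (s⁻¹ : Equiv.Perm K) = d := by ext x; simp
  simpa only [this] using hd

end Codes

section Conjugacy

variable {K : Type*} [Field K] [Algebra (ZMod 2) K]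

/-- The group of permutations induced by affine automorphisms of the graph of `g`. -/
def graphAut (g : K → K) : Subgroup (Equiv.Perm K) where
  carrier := {s | IsGraphEquiv s g g}
  mul_mem' hs ht := IsGraphEquiv.mul hs ht
  one_mem' := IsGraphEquiv.refl g
  inv_mem' hs := IsGraphEquiv.inv hs

/-- `H` is the translation group of a quadratic APN function transported to the graph of `g`. -/
def IsTranslationGroup (g : K → K) (H : Subgroup (graphAut g)) : Prop :=
  ∃ (h : K → K) (τ : Equiv.Perm K), IsQuadraticFun h ∧ IsAPN h ∧ IsGraphEquiv τ h g ∧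
    ∀ s : graphAut g, s ∈ H ↔ ∃ a, ∀ x, τ (s.1 x) = τ x + a

/-- The subgroup of the graph automorphisms of `g` obtained by transporting translations along
`τ`. -/
def translationSubgroup (g : K → K) (τ : Equiv.Perm K) : Subgroup (graphAut g) where
  carrier := {s | ∃ a, ∀ x, τ (s.1 x) = τ x + a}
  mul_mem' := by
    rintro s t ⟨a, ha⟩ ⟨b, hb⟩
    exact ⟨b + a, fun x => by simp [ha, hb, add_assoc]⟩
  one_mem' := ⟨0, fun x => by simp⟩
  inv_mem' := by
    rintro s ⟨a, ha⟩
    refine ⟨-a, fun x => ?_⟩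
    have := ha (s.1⁻¹ x)
    rw [show s.1 (s.1⁻¹ x) = x from s.1.apply_symm_apply x] at this
    change τ (s.1⁻¹ x) = _
    rw [this]
    ring

theorem isTranslationGroup_translationSubgroup {g h : K → K} {τ : Equiv.Perm K}
    (hq : IsQuadraticFun h) (hapn : IsAPN h) (hτ : IsGraphEquiv τ h g) :
    IsTranslationGroup g (translationSubgroup g τ) :=
  ⟨h, τ, hq, hapn, hτ, fun _ => Iff.rfl⟩

theorem exists_graphAut_eq_translation {g h : K → K} {τ : Equiv.Perm K}
    (hq : IsQuadraticFun h) (hτ : IsGraphEquiv τ h g) (a : K) :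
    ∃ s : graphAut g, ∀ x, τ (s.1 x) = τ x + a :=
  ⟨⟨τ⁻¹ * Equiv.addRight a * τ, (hτ.inv.mul (hq.isGraphEquiv_addRight a)).mul hτ⟩,
    fun x => by simp⟩

theorem IsTranslationGroup.map_conj {g : K → K} {H : Subgroup (graphAut g)}
    (hH : IsTranslationGroup g H) (t : graphAut g) :
    IsTranslationGroup g (H.map (MulAut.conj t).toMonoidHom) := by
  obtain ⟨h, τ, hq, hapn, hτ, hmem⟩ := hH
  refine ⟨h, τ * t.1⁻¹, hq, hapn, hτ.mul t.2.inv, fun s => ?_⟩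
  constructor
  · rintro ⟨y, hy, rfl⟩
    obtain ⟨a, ha⟩ := (hmem y).mp hy
    exact ⟨a, fun x => by simp [ha]⟩
  · rintro ⟨a, ha⟩
    refine ⟨t⁻¹ * s * t, (hmem _).mpr ⟨a, fun x => ?_⟩, by simp [mul_assoc]⟩
    have := ha (t.1 x)
    simpa using this

theorem IsTranslationGroup.isPGroup {g : K → K} {H : Subgroup (graphAut g)}
    (hH : IsTranslationGroup g H) : IsPGroup 2 H := by
  have := charP_two_of_algebra_zmod K
  obtain ⟨h, τ, hq, hapn, hτ, hmem⟩ := hH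
  rintro ⟨s, hs⟩
  obtain ⟨a, ha⟩ := (hmem s).mp hs
  refine ⟨1, ?_⟩
  ext x
  apply τ.injective
  simp only [pow_one, pow_two, Subgroup.coe_mul, Subgroup.coe_one, Equiv.Perm.mul_apply,
    Equiv.Perm.one_apply, ha]
  grind

theorem IsTranslationGroup.le_of_mutually_normalizing [Finite K]
    (hfin : 4 ≤ Module.finrank (ZMod 2) K) {g : K → K} {H H' : Subgroup (graphAut g)}
    (hH : IsTranslationGroup g H) (hH' : IsTranslationGroup g H')
    (hn : H ≤ Subgroup.normalizer (H' : Set (graphAut g)))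
    (hn' : H' ≤ Subgroup.normalizer (H : Set (graphAut g))) : H' ≤ H := by
  have := charP_two_of_algebra_zmod K
  obtain ⟨h, τ, hq, hapn, hτ, hmem⟩ := hH
  obtain ⟨h', τ', hq', hapn', hτ', hmem'⟩ := hH'
  choose s hs using exists_graphAut_eq_translation hq hτ
  choose s' hs' using exists_graphAut_eq_translation hq' hτ'
  have hsH : ∀ a, s a ∈ H := fun a => (hmem _).mpr ⟨a, hs a⟩
  have hsH' : ∀ a, s' a ∈ H' := fun a => (hmem' _).mpr ⟨a, hs' a⟩
  have hs1 : ∀ a x, (s a).1 (τ.symm x) = τ.symm (x + a) := fun a x => τ.injective (by simp [hs])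
  have key := hq.isTranslation_of_mutually_normalizing hapn hq' (hτ'.mul hτ.inv) hfin
    (fun a x => τ ((s' a).1 (τ.symm x))) (fun a x => by simp [hs'])
    (fun a b => by
      have hc := (Subgroup.mem_normalizer_iff.mp (hn' (hsH' a)) (s b)).mp (hsH b)
      obtain ⟨c, hc⟩ := (hmem _).mp hc
      refine ⟨c, fun x => ?_⟩
      have := hc ((s' a).1 (τ.symm x))
      simpa [hs1] using this)
    (fun a b => by
      have hc := (Subgroup.mem_normalizer_iff.mp (hn (hsH b)) (s' a)).mp (hsH' a)
      obtain ⟨c, hc⟩ := (hmem' _).mp hc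
      refine ⟨c, fun x => ?_⟩
      have h1 := hc ((s b).1 (τ.symm (x + b)))
      rw [hs1, add_assoc, CharTwo.add_self_eq_zero, add_zero] at h1
      have h2 : (s' c).1 (τ.symm x) = (s b).1 ((s' a).1 (τ.symm (x + b))) := by
        apply τ'.injective
        rw [hs', ← h1]
        have h3 : (s b).1⁻¹ (τ.symm x) = τ.symm (x + b) := by
          rw [Equiv.Perm.inv_eq_iff_eq, hs1, add_assoc, CharTwo.add_self_eq_zero, add_zero]
        rw [← h3]
        rfl
      rw [h2, hs])
  intro y hy
  obtain ⟨a, ha⟩ := (hmem' y).mp hy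
  obtain ⟨c, hc⟩ := key a
  refine (hmem y).mpr ⟨c, fun x => ?_⟩
  have h1 := hc (τ x)
  rw [← h1]
  congr 1
  apply τ'.injective
  simp [ha, hs']

theorem exists_isGraphEquiv_map_add [Finite K] (hfin : 4 ≤ Module.finrank (ZMod 2) K)
    {f g : K → K} (hf : IsQuadraticFun f) (hfapn : IsAPN f) (hg : IsQuadraticFun g)
    (hgapn : IsAPN g) {σ : Equiv.Perm K} (hσ : IsGraphEquiv σ f g) :
    ∃ τ : Equiv.Perm K, IsGraphEquiv τ f g ∧ ∀ b, ∃ a, ∀ x, τ (x + b) = τ x + a := by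
  obtain ⟨t, ht⟩ := exists_conj_of_mutually_normalizing_eq 2 (IsTranslationGroup g)
    (fun H t hH => hH.map_conj t) (fun H hH => hH.isPGroup)
    (fun H H' hH hH' hn hn' => le_antisymm
      (IsTranslationGroup.le_of_mutually_normalizing hfin hH' hH hn' hn)
      (IsTranslationGroup.le_of_mutually_normalizing hfin hH hH' hn hn'))
    (isTranslationGroup_translationSubgroup hg hgapn (IsGraphEquiv.refl g))
    (isTranslationGroup_translationSubgroup hf hfapn hσ)
  refine ⟨σ * t.1, hσ.mul t.2, fun b => ?_⟩
  obtain ⟨s, hs⟩ := exists_graphAut_eq_translation hg (IsGraphEquiv.refl g) b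
  have hmem : t * s * t⁻¹ ∈ translationSubgroup g σ := by
    rw [ht]
    exact ⟨s, ⟨b, hs⟩, rfl⟩
  obtain ⟨a, ha⟩ := hmem
  refine ⟨a, fun x => ?_⟩
  have h1 := ha (t.1 x)
  have h2 := hs x
  simp only [Equiv.Perm.one_apply] at h2
  simpa [h2] using h1

end Conjugacy

section EquivalenceFromTranslations

variable {K : Type*} [Field K] [Algebra (ZMod 2) K]

theorem isAffineMap_of_map_add_eq {τ : K → K} (h : ∀ b, ∃ a, ∀ x, τ (x + b) = τ x + a) :
    IsAffineMap τ := by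
  refine ⟨(AddMonoidHom.mk' (fun x => τ x - τ 0) fun x y => ?_).toZModLinearMap 2, τ 0,
    fun x => by simp⟩
  obtain ⟨a, ha⟩ := h y
  have h0 := ha 0
  rw [zero_add] at h0
  rw [ha, h0]
  ring

/-- A graph equivalence which is affine on `K` yields an EA-equivalence. -/
theorem IsGraphEquiv.eaEquiv_of_map_add [Finite K] {f g : K → K} {τ : Equiv.Perm K}
    (hg : ∀ S : K →ₗ[ZMod 2] K, (∀ x y, S (polarForm g x y) = 0) → S = 0)
    (hq : IsQuadraticFun g)
    (hτ : IsGraphEquiv τ f g) (hadd : ∀ b, ∃ a, ∀ x, τ (x + b) = τ x + a) : EAEquiv f g := by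
  have := charP_two_of_algebra_zmod K
  have haff := isAffineMap_of_map_add_eq hadd
  obtain ⟨A, c, hA⟩ := id haff
  obtain ⟨M, R, v, hM⟩ := hτ.1.exists_snd
  obtain ⟨Q, P, w, hQ⟩ := hτ.2.exists_snd
  have hQ' : ∀ x, g x = Q (f (τ x)) + (P (A x) + (P c + w)) := fun x => by
    have := hQ (τ x)
    rw [show τ⁻¹ (τ x) = x from τ.symm_apply_apply x, hA x, map_add] at this
    rw [this, hA x]
    ring
  have hQM : Q ∘ₗ M - LinearMap.id = 0 := by
    refine hg _ fun x y => ?_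
    have key : ∀ x, (Q ∘ₗ M - LinearMap.id : K →ₗ[ZMod 2] K) (g x) =
        Q (R x) + Q v + P (A x) + (P c + w) := by
      intro x
      have h1 := hQ' x
      rw [hM] at h1
      simp only [map_add, LinearMap.sub_apply, LinearMap.comp_apply, LinearMap.id_apply] at h1 ⊢
      grind
    have h0 := key 0
    rw [hq.map_zero] at h0
    simp only [polarForm, map_add, key] at h0 ⊢
    simp only [_root_.map_zero] at h0
    grind
  have hsurj : Function.Surjective Q := fun x => ⟨M x, by
    have := LinearMap.congr_fun hQM x
    simpa [sub_eq_zero] using this⟩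
  exact ⟨Q, τ, fun x => P (A x) + (P c + w), ⟨Q, 0, fun x => by simp⟩,
    Finite.injective_iff_bijective.mp (Finite.injective_iff_surjective.mpr hsurj), haff,
    τ.bijective, ⟨P ∘ₗ A, P c + w, fun x => rfl⟩, hQ'⟩

end EquivalenceFromTranslations

section SmallDimension

variable {K : Type*} [Field K] [Algebra (ZMod 2) K] {f g : K → K}

theorem eaEquiv_of_linear_polarForm {S : K →ₗ[ZMod 2] K} (hS : Function.Bijective S)
    (h : ∀ x y, S (polarForm f x y) = polarForm g x y) : EAEquiv f g := by
  have := charP_two_of_algebra_zmod K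
  refine ⟨S, id, fun x => g x + S (f x), ⟨S, 0, fun x => by simp⟩, hS,
    ⟨LinearMap.id, 0, fun x => by simp⟩, Function.bijective_id,
    ⟨(AddMonoidHom.mk' (fun x => g x + S (f x)) fun x y => ?_).toZModLinearMap 2, 0,
      fun x => by simp⟩, fun x => by simp only [id]; grind⟩
  have := h x y
  simp only [polarForm, map_add] at this
  grind

theorem IsQuadraticFun.map_polarForm_eq_of_basis {ι : Type*} [LinearOrder ι] [Finite ι]
    (hf : IsQuadraticFun f) (hg : IsQuadraticFun g) (b : Module.Basis ι (ZMod 2) K)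
    (S : K →ₗ[ZMod 2] K)
    (h : ∀ i j, i < j → S (polarForm f (b i) (b j)) = polarForm g (b i) (b j)) (x y : K) :
    S (polarForm f x y) = polarForm g x y := by
  have h' : ∀ i j, S (polarForm f (b i) (b j)) = polarForm g (b i) (b j) := by
    intro i j
    rcases lt_trichotomy i j with hij | rfl | hij
    · exact h i j hij
    · rw [hf.polarForm_self, hg.polarForm_self, _root_.map_zero]
    · rw [polarForm_comm f, polarForm_comm g, h j i hij]
  have h1 : ∀ i y, S (polarForm f (b i) y) = polarForm g (b i) y := by
    intro i y
    have : S ∘ₗ hf.polarLin (b i) = hg.polarLin (b i) :=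
      b.ext fun j => by simp [polarLin_apply, h']
    simpa [polarLin_apply] using LinearMap.congr_fun this y
  have : S ∘ₗ hf.polarLin y = hg.polarLin y :=
    b.ext fun i => by simp [polarLin_apply, polarForm_comm _ y, h1]
  simpa [polarLin_apply, polarForm_comm _ y] using LinearMap.congr_fun this x

variable [Finite K]

/-- In dimension three, the polar form of an APN quadratic function sends the three pairs of a
basis to linearly independent vectors. -/
theorem IsQuadraticFun.linearIndependent_polarForm (hf : IsQuadraticFun f) (hapn : IsAPN f)
    (b : Module.Basis (Fin 3) (ZMod 2) K) :
    LinearIndependent (ZMod 2)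
      ![polarForm f (b 1) (b 2), polarForm f (b 0) (b 2), polarForm f (b 0) (b 1)] := by
  have := charP_two_of_algebra_zmod K
  have hz : ∀ z : ZMod 2, z = 0 ∨ z = 1 := by decide
  have hli := Fintype.linearIndependent_iff.mp b.linearIndependent
  simp only [Fin.sum_univ_three] at hli
  have ne : ∀ c : Fin 3 → ZMod 2, (∃ i, c i ≠ 0) → c 0 • b 0 + c 1 • b 1 + c 2 • b 2 ≠ 0 :=
    fun c ⟨i, hi⟩ h => hi (hli c h i)
  have n0 : b 0 ≠ 0 := by simpa using ne ![1, 0, 0] ⟨0, by simp⟩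
  have n1 : b 1 ≠ 0 := by simpa using ne ![0, 1, 0] ⟨1, by simp⟩
  have n2 : b 2 ≠ 0 := by simpa using ne ![0, 0, 1] ⟨2, by simp⟩
  have n01 : b 0 + b 1 ≠ 0 := by simpa using ne ![1, 1, 0] ⟨0, by simp⟩
  have n02 : b 0 + b 2 ≠ 0 := by simpa using ne ![1, 0, 1] ⟨0, by simp⟩
  have n12 : b 1 + b 2 ≠ 0 := by simpa using ne ![0, 1, 1] ⟨1, by simp⟩
  have n012 : b 0 + b 1 + b 2 ≠ 0 := by simpa using ne ![1, 1, 1] ⟨0, by simp⟩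
  have key : ∀ x y, x ≠ 0 → y ≠ 0 → x + y ≠ 0 → polarForm f x y ≠ 0 := by
    intro x y hx hy hxy h
    rcases hf.eq_zero_or_eq_of_polarForm_eq_zero hapn hx h with rfl | rfl
    · exact hy rfl
    · exact hxy (CharTwo.add_self_eq_zero _)
  have k1 := key (b 1) (b 2) n1 n2 n12
  have k2 := key (b 0) (b 2) n0 n2 n02
  have k3 := key (b 0) (b 1) n0 n1 n01
  have k4 := key (b 0 + b 1) (b 2) n01 n2 n012
  have k5 := key (b 1) (b 0 + b 2) n1 n02 (by grind)
  have k6 := key (b 0) (b 1 + b 2) n0 n12 (by grind)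
  have k7 := key (b 0 + b 1) (b 1 + b 2) n01 n12 (by grind)
  simp only [hf.polarForm_add_left, hf.polarForm_add_right, hf.polarForm_self,
    polarForm_comm f (b 1) (b 0)] at k4 k5 k6 k7
  rw [Fintype.linearIndependent_iff]
  intro c hc
  simp only [Fin.sum_univ_three, Matrix.cons_val] at hc
  rcases hz (c 0) with h0 | h0 <;> rcases hz (c 1) with h1 | h1 <;>
    rcases hz (c 2) with h2 | h2 <;> simp only [h0, h1, h2, zero_smul, one_smul] at hc
  · intro i
    fin_cases i <;> assumption
  all_goals grind

theorem IsQuadraticFun.eaEquiv_of_finrank_le_three (hf : IsQuadraticFun f) (hfapn : IsAPN f)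
    (hg : IsQuadraticFun g) (hgapn : IsAPN g) (hfin : Module.finrank (ZMod 2) K ≤ 3) :
    EAEquiv f g := by
  have := charP_two_of_algebra_zmod K
  have hpos : 0 < Module.finrank (ZMod 2) K := Module.finrank_pos
  obtain h | h | h : Module.finrank (ZMod 2) K = 1 ∨ Module.finrank (ZMod 2) K = 2 ∨
    Module.finrank (ZMod 2) K = 3 := by omega
  · let b := Module.finBasisOfFinrankEq (ZMod 2) K h
    refine eaEquiv_of_linear_polarForm (S := LinearMap.id) Function.bijective_id
      (hf.map_polarForm_eq_of_basis hg b _ fun i j hij => ?_)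
    omega
  · let b := Module.finBasisOfFinrankEq (ZMod 2) K h
    have hne : ∀ {h : K → K}, IsQuadraticFun h → IsAPN h → polarForm h (b 0) (b 1) ≠ 0 := by
      intro h hq hapn h0
      rcases hq.eq_zero_or_eq_of_polarForm_eq_zero hapn (b.ne_zero 0) h0 with h1 | h1
      · exact b.ne_zero 1 h1
      · exact absurd (b.injective h1) (by decide)
    have hc : polarForm g (b 0) (b 1) / polarForm f (b 0) (b 1) ≠ 0 :=
      div_ne_zero (hne hg hgapn) (hne hf hfapn)
    refine eaEquiv_of_linear_polarForm
      (S := LinearMap.mulLeft (ZMod 2) (polarForm g (b 0) (b 1) / polarForm f (b 0) (b 1)))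
      (mulLeft_bijective₀ _ hc) (hf.map_polarForm_eq_of_basis hg b _ fun i j hij => ?_)
    obtain ⟨rfl, rfl⟩ : i = 0 ∧ j = 1 := by omega
    rw [LinearMap.mulLeft_apply, div_mul_cancel₀ _ (hne hf hfapn)]
  · let b := Module.finBasisOfFinrankEq (ZMod 2) K h
    let bf := basisOfLinearIndependentOfCardEqFinrank
      (hf.linearIndependent_polarForm hfapn b) (by simp [h])
    let bg := basisOfLinearIndependentOfCardEqFinrank
      (hg.linearIndependent_polarForm hgapn b) (by simp [h])
    let S := bf.equiv bg (Equiv.refl _)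
    have hS : ∀ i, S (bf i) = bg i := fun i => by simp [S]
    simp only [bf, bg, coe_basisOfLinearIndependentOfCardEqFinrank] at hS
    refine eaEquiv_of_linear_polarForm (S := S.toLinearMap) S.bijective
      (hf.map_polarForm_eq_of_basis hg b _ fun i j hij => ?_)
    obtain ⟨rfl, rfl⟩ | ⟨rfl, rfl⟩ | ⟨rfl, rfl⟩ :
      (i = 1 ∧ j = 2) ∨ (i = 0 ∧ j = 2) ∨ (i = 0 ∧ j = 1) := by omega
    · exact hS 0
    · exact hS 1
    · exact hS 2

end SmallDimension

theorem pow_two_pow_gcd_eq_self {K : Type*} [Field K] [CharP K 2] {x : K}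
    {k n : ℕ} (hk : x ^ 2 ^ k = x) (hn : x ^ 2 ^ n = x) : x ^ 2 ^ k.gcd n = x := by
  have : ∀ m, x ^ 2 ^ m = x ↔ Function.IsPeriodicPt (frobenius K 2) m x := by
    intro m
    rw [Function.IsPeriodicPt, Function.IsFixedPt, iterate_frobenius]
  rw [this] at hk hn ⊢
  exact hk.gcd hn

section Gold

variable {K : Type*} [Field K] [Algebra (ZMod 2) K]

theorem polarForm_gold (r : ℕ) (x y : K) :
    polarForm (fun x : K => x ^ (2 ^ r + 1)) x y = x ^ 2 ^ r * y + x * y ^ 2 ^ r := by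
  have := charP_two_of_algebra_zmod K
  simp only [polarForm, pow_succ, add_pow_char_pow]
  grind

theorem isQuadraticFun_gold (r : ℕ) : IsQuadraticFun fun x : K => x ^ (2 ^ r + 1) := by
  have := charP_two_of_algebra_zmod K
  intro a
  have h : (fun x : K => (x + a) ^ (2 ^ r + 1) + x ^ (2 ^ r + 1) + a ^ (2 ^ r + 1)) =
      fun x => x ^ 2 ^ r * a + x * a ^ 2 ^ r := funext fun x => polarForm_gold r x a
  simp only
  rw [h]
  exact ((AddMonoidHom.mk' (fun x : K => x ^ 2 ^ r * a + x * a ^ 2 ^ r) fun x y => by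
    rw [add_pow_char_pow]; ring).toZModLinearMap 2).isLinear

variable [Fintype K] {n r : ℕ}

theorem isAPN_gold (hcard : Fintype.card K = 2 ^ n) (hr : r.gcd n = 1) :
    IsAPN fun x : K => x ^ (2 ^ r + 1) := by
  have := charP_two_of_algebra_zmod K
  intro a b ha
  by_cases hne : {x : K | (x + a) ^ (2 ^ r + 1) + x ^ (2 ^ r + 1) = b} = ∅
  · rw [hne]; simp
  obtain ⟨x₀, hx₀⟩ := Set.nonempty_iff_ne_empty.mpr hne
  refine (Set.ncard_le_ncard (t := {x₀, x₀ + a}) (fun x hx => ?_) (Set.toFinite _)).trans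
    (Set.ncard_insert_le _ _ |>.trans (by simp))
  have h1 := polarForm_gold r x a
  have h2 := polarForm_gold r x₀ a
  simp only [Set.mem_ofPred_eq] at hx hx₀
  simp only [polarForm, hx, hx₀] at h1 h2
  have h3 : (x + x₀) ^ 2 ^ r * a = (x + x₀) * a ^ 2 ^ r := by
    rw [add_pow_char_pow]
    grind
  have h4 : ((x + x₀) / a) ^ 2 ^ r = (x + x₀) / a := by
    rw [div_pow, div_eq_div_iff (pow_ne_zero _ ha) ha, h3]
  have h5 := pow_two_pow_gcd_eq_self h4 (hcard ▸ FiniteField.pow_card _)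
  rw [hr, pow_one, sq] at h5
  replace h5 := IsIdempotentElem.iff_eq_zero_or_one.mp h5
  rcases h5 with h5 | h5
  · rw [div_eq_zero_iff, or_iff_left ha] at h5
    left; grind
  · rw [div_eq_one_iff_eq ha] at h5
    right
    simp only [Set.mem_singleton_iff]
    grind

theorem eq_zero_of_apply_polarForm_gold (hcard : Fintype.card K = 2 ^ n) (hr : r.gcd n = 1)
    (hn : 3 ≤ n) (S : K →ₗ[ZMod 2] K)
    (hS : ∀ x y, S (polarForm (fun x : K => x ^ (2 ^ r + 1)) x y) = 0) : S = 0 := by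
  have := charP_two_of_algebra_zmod K
  have hnd := traceForm_nondegenerate (ZMod 2) K
  have hsep : ∀ z : K, (∀ y, Algebra.trace (ZMod 2) K (z * y) = 0) → z = 0 := fun z hz =>
    hnd.1 z hz
  have hfrob : ∀ x : K, Algebra.trace (ZMod 2) K (x ^ 2 ^ r) = Algebra.trace (ZMod 2) K x := by
    intro x
    clear hS hr
    induction r with
    | zero => simp
    | succ r ih =>
      have h1 := Algebra.trace_eq_of_algEquiv
        (FiniteField.frobeniusAlgEquivOfAlgebraic (ZMod 2) K) (x ^ 2 ^ r)
      rw [FiniteField.coe_frobeniusAlgEquivOfAlgebraic, ZMod.card] at h1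
      simp only [← pow_mul, ← pow_succ] at h1
      rw [h1, ih]
  have hcardpow : ∀ x : K, x ^ 2 ^ n = x := fun x => hcard ▸ FiniteField.pow_card x
  have hsurj : Function.Surjective fun x : K => x ^ 2 ^ r :=
    Finite.injective_iff_surjective.mp (iterateFrobenius_inj K 2 r)
  have hβ : ∀ β : K, (∀ x y, Algebra.trace (ZMod 2) K
      (β * polarForm (fun x : K => x ^ (2 ^ r + 1)) x y) = 0) → β = 0 := by
    intro β hβ
    have h1 : ∀ a, β * a + β ^ 2 ^ r * (a ^ 2 ^ r) ^ 2 ^ r = 0 := by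
      intro a
      refine hsep _ fun z => ?_
      obtain ⟨x, rfl⟩ := hsurj z
      have h2 := hβ x a
      rw [polarForm_gold, mul_add, map_add, ← hfrob (β * (x * a ^ 2 ^ r)), ← map_add] at h2
      rw [← h2]
      congr 1
      simp only [mul_pow]
      ring
    by_contra hne
    have h2 := h1 1
    simp only [one_pow, mul_one] at h2
    have h3 : ∀ a : K, a ^ 2 ^ (2 * r) = a := by
      intro a
      have h4 := h1 a
      have h5 : β ^ 2 ^ r = β := by grind
      rw [h5, ← mul_add] at h4
      have h6 := (mul_eq_zero.mp h4).resolve_left hne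
      rw [← pow_mul, ← pow_add, ← two_mul] at h6
      grind
    have hd : (2 * r).gcd n ∣ 2 := by
      have : Nat.Coprime ((2 * r).gcd n) r :=
        Nat.Coprime.coprime_dvd_left (Nat.gcd_dvd_right _ _) (Nat.coprime_comm.mp hr)
      exact this.dvd_of_dvd_mul_right (Nat.gcd_dvd_left _ _)
    have h4 : ∀ a : K, a ^ 4 = a := by
      intro a
      have h5 := pow_two_pow_gcd_eq_self (h3 a) (hcardpow a)
      rcases (Nat.dvd_prime Nat.prime_two).mp hd with h6 | h6 <;> rw [h6] at h5
      · grind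
      · exact h5
    have h5 : Fintype.card K - 1 ∣ 3 := by
      refine (FiniteField.forall_pow_eq_one_iff K 3).mp fun x => ?_
      have h6 := h4 x
      rw [pow_succ, mul_eq_right₀ x.ne_zero] at h6
      exact Units.ext (by simpa using h6)
    have h6 := Nat.le_of_dvd (by norm_num) h5
    have h7 : 2 ^ 3 ≤ 2 ^ n := Nat.pow_le_pow_right (by norm_num) hn
    omega
  ext x
  refine hsep _ fun γ => ?_
  let φ : Module.Dual (ZMod 2) K :=
    Algebra.trace (ZMod 2) K ∘ₗ LinearMap.mulRight (ZMod 2) γ ∘ₗ S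
  obtain ⟨β, hβφ⟩ := (LinearMap.BilinForm.toDual _ hnd).surjective φ
  have hφ : ∀ z, Algebra.trace (ZMod 2) K (β * z) = Algebra.trace (ZMod 2) K (S z * γ) :=
    fun z => LinearMap.congr_fun hβφ z
  have h0 : β = 0 := hβ β fun x y => by rw [hφ, hS, zero_mul, _root_.map_zero]
  rw [← hφ, h0, zero_mul, _root_.map_zero]

end Gold

/-- If a quadratic APN function `f` is CCZ-equivalent to a Gold function
`g(x) = x^(2^r+1)` (with `gcd(r,n) = 1`), then `f` and `g` are EA-equivalent. -/
theorem stmt8 {K : Type*} [Field K] [Fintype K] [Algebra (ZMod 2) K]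
    (n : ℕ) (hn : 1 ≤ n) (hcard : Fintype.card K = 2 ^ n)
    (r : ℕ) (hr : Nat.gcd r n = 1)
    (f : K → K)
    (hquad : ∀ a : K, IsLinearMap (ZMod 2) fun x => f (x + a) + f x + f a)
    (hapn : IsAPN f)
    (g : K → K) (hg : g = fun x => x ^ (2 ^ r + 1))
    (hccz : ∃ σ : Equiv.Perm K, (fun c : K → ZMod 2 => c ∘ ⇑σ) '' code f = code g) :
    EAEquiv f g := by
  subst hg
  have hquad' : IsQuadraticFun f := hquad
  have hgq := isQuadraticFun_gold (K := K) r
  have hga := isAPN_gold (K := K) hcard hr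
  obtain ⟨σ, hσ⟩ := hccz
  have hfin : Module.finrank (ZMod 2) K = n := by
    have := Module.card_eq_pow_finrank (K := ZMod 2) (V := K)
    rw [hcard, ZMod.card] at this
    exact (Nat.pow_right_injective le_rfl this).symm
  by_cases h : n ≤ 3
  · exact hquad'.eaEquiv_of_finrank_le_three hapn hgq hga (by omega)
  · obtain ⟨τ, hτ, hadd⟩ := exists_isGraphEquiv_map_add (by omega) hquad' hapn hgq hga
      (isGraphEquiv_of_image_code hσ)
    exact hτ.eaEquiv_of_map_add (eq_zero_of_apply_polarForm_gold hcard hr (by omega)) hgq hadd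
end

section
/- Let 𝒢 be the subgroup of Sym(K) consisting of all maps x ↦ a·γ(x) + t with a ∈ K^*, t ∈ K and γ ∈ Gal(K/F_2). Let h : K → K be a quadratic APN function such that Aut(C_h) is isomorphic (as an abstract group) to a subgroup of 𝒢. Then every quadratic APN function f : K → K that is CCZ-equivalent to h (i.e., σ(C_f) = C_h for some permutation σ of K) is EA-equivalent to h. -/
/-- The automorphism group of a code `C ⊆ F₂^K`: the subgroup of `Sym(K)` of
permutations `π` with `{c ∘ π : c ∈ C} = C`. -/
def autCode {K : Type*} (C : Set (K → ZMod 2)) : Subgroup (Equiv.Perm K) where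
  carrier := {π | (fun c : K → ZMod 2 => c ∘ ⇑π) '' C = C}
  one_mem' := by
    have : (fun c : K → ZMod 2 => c ∘ ⇑(1 : Equiv.Perm K)) = id := by
      funext c; rfl
    simp [this]
  mul_mem' := by
    intro π σ hπ hσ
    have hcomp : (fun c : K → ZMod 2 => c ∘ ⇑(π * σ)) =
        (fun c : K → ZMod 2 => c ∘ ⇑σ) ∘ (fun c : K → ZMod 2 => c ∘ ⇑π) := by
      funext c; rfl
    show (fun c : K → ZMod 2 => c ∘ ⇑(π * σ)) '' C = C
    rw [hcomp, Set.image_comp]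
    rw [show (fun c : K → ZMod 2 => c ∘ ⇑π) '' C = C from hπ]
    exact hσ
  inv_mem' := by
    intro π hπ
    show (fun c : K → ZMod 2 => c ∘ ⇑π⁻¹) '' C = C
    conv_lhs => rw [← show (fun c : K → ZMod 2 => c ∘ ⇑π) '' C = C from hπ]
    rw [← Set.image_comp]
    have : ((fun c : K → ZMod 2 => c ∘ ⇑π⁻¹) ∘ fun c : K → ZMod 2 => c ∘ ⇑π) = id := by
      funext c
      show (c ∘ ⇑π) ∘ ⇑π⁻¹ = c
      funext x
      simp
    rw [this, Set.image_id]

/-- The group `𝒢` inside `Sym(K)`: all maps `x ↦ a·γ(x) + t` with `a ∈ K^*`, `t ∈ K`,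
`γ ∈ Gal(K/F₂)`, as a set of permutations. -/
def semiAffineSet (K : Type*) [Field K] [Algebra (ZMod 2) K] : Set (Equiv.Perm K) :=
  {π | ∃ (a : K) (γ : K ≃ₐ[ZMod 2] K) (t : K), a ≠ 0 ∧ ∀ x, π x = a * γ x + t}

section LinearAlgebra

/-- Two linear maps with the same kernel differ by an automorphism of the target. -/
theorem LinearMap.exists_linearEquiv_of_ker_eq {F V W : Type*} [Field F] [AddCommGroup V]
    [Module F V] [AddCommGroup W] [Module F W] [FiniteDimensional F W] {X Y : V →ₗ[F] W}
    (hker : LinearMap.ker X = LinearMap.ker Y) : ∃ e : W ≃ₗ[F] W, ∀ v, Y v = e (X v) := by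
  obtain ⟨e, he⟩ := Submodule.exists_linearEquiv_restrict_eq
    (X.quotKerEquivRange.symm ≪≫ₗ Submodule.quotEquivOfEq _ _ hker ≪≫ₗ Y.quotKerEquivRange)
  refine ⟨e, fun v => ?_⟩
  have hv := he ⟨X v, v, rfl⟩
  have hq : X.quotKerEquivRange.symm ⟨X v, v, rfl⟩ = (LinearMap.ker X).mkQ v :=
    X.quotKerEquivRange_symm_apply_image v ⟨v, rfl⟩
  simpa [hq] using hv

end LinearAlgebra

section CharTwo

variable {K : Type*} [Field K] [Algebra (ZMod 2) K]

variable (K) in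
theorem two_eq_zero_of_algebra : (2 : K) = 0 := by
  have : CharP K 2 := charP_of_injective_algebraMap (algebraMap (ZMod 2) K).injective 2
  exact CharTwo.two_eq_zero

/-- A map whose polarization vanishes is affine. -/
theorem isAffineMap_of_map_add {A : K → K} (hA : ∀ x y, A (x + y) = A x + A y + A 0) :
    IsAffineMap A := by
  have h2 := two_eq_zero_of_algebra K
  refine ⟨(AddMonoidHom.mk' (fun x => A x + A 0) fun x y => ?_).toZModLinearMap 2, A 0,
    fun x => ?_⟩
  · rw [hA]; ring
  · change A x = A x + A 0 + A 0
    linear_combination -A 0 * h2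

/-- The polarization of a quadratic function, as a bilinear map. -/
def polarization (f : K → K)
    (hf : ∀ a : K, IsLinearMap (ZMod 2) fun x => f (x + a) + f x + f a) :
    K →ₗ[ZMod 2] K →ₗ[ZMod 2] K :=
  LinearMap.mk₂ (ZMod 2) (fun x a => f (x + a) + f x + f a)
    (fun x y a => (hf a).map_add x y) (fun c x a => (hf a).map_smul c x)
    (fun a x y => by
      have h := (hf a).map_add x y
      simp only [add_comm a, add_right_comm _ (f a)]
      exact h.trans (add_right_comm _ _ _))
    (fun c a x => by
      have h := (hf a).map_smul c x
      simp only [add_comm a, add_right_comm _ (f a)]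
      exact h)

variable {f : K → K} (hf : ∀ a : K, IsLinearMap (ZMod 2) fun x => f (x + a) + f x + f a)

theorem polarization_apply (x a : K) : polarization f hf x a = f (x + a) + f x + f a := rfl

include hf in
theorem map_zero_of_quadratic : f 0 = 0 := by
  have h := (hf 0).map_zero
  have h2 := two_eq_zero_of_algebra K
  simp only [add_zero] at h
  linear_combination h - f 0 * h2

theorem map_add_eq_polarization (x a : K) : f (x + a) = f x + f a + polarization f hf x a := by
  have h2 := two_eq_zero_of_algebra K
  rw [polarization_apply]
  linear_combination -(f x + f a) * h2

theorem polarization_self (x : K) : polarization f hf x x = 0 := by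
  have h2 := two_eq_zero_of_algebra K
  have hx : x + x = 0 := by linear_combination x * h2
  rw [polarization_apply, hx, map_zero_of_quadratic hf]
  linear_combination f x * h2

theorem polarization_comm (x y : K) : polarization f hf x y = polarization f hf y x := by
  rw [polarization_apply, polarization_apply, add_comm x y]
  ring

theorem polarization_ne_zero [Finite K] (hapn : IsAPN f) {x a : K} (ha : a ≠ 0) (hx : x ≠ 0)
    (hxa : x ≠ a) : polarization f hf x a ≠ 0 := by
  intro h0
  have hsub : ({x, a, 0} : Set K) ⊆ {y | f (y + a) + f y = f a} := by
    have key : ∀ y, polarization f hf y a = 0 → f (y + a) + f y = f a := by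
      intro y hy
      have h2 := two_eq_zero_of_algebra K
      rw [polarization_apply] at hy
      linear_combination hy - f a * h2
    rintro y (rfl | rfl | rfl)
    · exact key _ h0
    · exact key _ (polarization_self hf y)
    · exact key _ (by simp)
  have h3 : ({x, a, 0} : Set K).ncard = 3 := Set.ncard_eq_three.mpr ⟨x, a, 0, hxa, hx, ha, rfl⟩
  have := Set.ncard_le_ncard hsub (Set.toFinite _)
  have := hapn a (f a) ha
  omega

/-- If the polarizations of `h` and `e ∘ f ∘ σ` agree for some affine permutation `σ` and linear
automorphism `e`, then `f` and `h` are EA-equivalent. -/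
theorem eaEquiv_of_polarization_eq {h : K → K} {σ : Equiv.Perm K} (hσ : IsAffineMap σ)
    (e : K ≃ₗ[ZMod 2] K)
    (he : ∀ x y, h (x + y) + h x + h y + h 0 =
      e (f (σ (x + y)) + f (σ x) + f (σ y) + f (σ 0))) : EAEquiv f h := by
  have h2 := two_eq_zero_of_algebra K
  refine ⟨e, σ, fun x => h x + e (f (σ x)), ⟨e, 0, fun x => by simp⟩, e.bijective, hσ,
    σ.bijective, isAffineMap_of_map_add fun x y => ?_, fun x => ?_⟩
  · have h1 := he x y
    simp only [map_add] at h1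
    linear_combination h1 + (e (f (σ (x + y))) - (h x + h y + h 0)) * h2
  · linear_combination -e (f (σ x)) * h2

end CharTwo

section SmallField

variable {K : Type*} [Field K] [Fintype K] [Algebra (ZMod 2) K]

/-- All quadratic APN functions on a field with at most four elements are EA-equivalent. -/
theorem eaEquiv_of_card_le_four (hK : Fintype.card K ≤ 4) {f h : K → K}
    (hf : ∀ a : K, IsLinearMap (ZMod 2) fun x => f (x + a) + f x + f a) (hfapn : IsAPN f)
    (hh : ∀ a : K, IsLinearMap (ZMod 2) fun x => h (x + a) + h x + h a) (hhapn : IsAPN h) :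
    EAEquiv f h := by
  classical
  have h2 := two_eq_zero_of_algebra K
  obtain ⟨c, hc0, hc⟩ : ∃ c : K, c ≠ 0 ∧
      ∀ x y, polarization h hh x y = c * polarization f hf x y := by
    by_cases hex : ∃ u : K, u ≠ 0 ∧ u ≠ 1
    · obtain ⟨u, hu0, hu1⟩ := hex
      have hfn := polarization_ne_zero hf hfapn one_ne_zero hu0 hu1
      have hhn := polarization_ne_zero hh hhapn one_ne_zero hu0 hu1
      have huniv : ({0, 1, u, u + 1} : Finset K) = Finset.univ := by
        apply Finset.eq_univ_of_card
        have h01 : u + 1 ≠ 0 := fun h => hu1 (by linear_combination h - h2)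
        have : ({0, 1, u, u + 1} : Finset K).card = 4 := by
          rw [Finset.card_insert_of_notMem, Finset.card_insert_of_notMem,
            Finset.card_pair] <;> simp [hu0, hu1.symm, hu0.symm, h01.symm]
        have := Finset.card_le_univ ({0, 1, u, u + 1} : Finset K)
        omega
      refine ⟨polarization h hh u 1 / polarization f hf u 1, div_ne_zero hhn hfn, ?_⟩
      have hmem : ∀ x : K, x = 0 ∨ x = 1 ∨ x = u ∨ x = u + 1 := fun x => by
        have : x ∈ ({0, 1, u, u + 1} : Finset K) := huniv ▸ Finset.mem_univ x
        simpa using this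
      intro x y
      rcases hmem x with hx | hx | hx | hx <;> rcases hmem y with hy | hy | hy | hy <;>
        simp [hx, hy, polarization_self, polarization_comm hf 1 u, polarization_comm hh 1 u,
          hfn, mul_add]
    · push Not at hex
      refine ⟨1, one_ne_zero, fun x y => ?_⟩
      by_cases hx : x = 0
      · simp [hx]
      by_cases hy : y = 0
      · simp [hy]
      simp [hex x hx, hex y hy, polarization_self]
  have hcf : ∀ x y, h (x + y) + h x + h y = c * (f (x + y) + f x + f y) := hc
  refine eaEquiv_of_polarization_eq (σ := 1) ⟨LinearMap.id, 0, fun x => by simp⟩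
    (LinearEquiv.smulOfNeZero K K c hc0 |>.restrictScalars (ZMod 2)) fun x y => ?_
  simp [hcf, map_zero_of_quadratic hf, map_zero_of_quadratic hh]

end SmallField

section Code

variable {K : Type*} [Field K] [Fintype K] [Algebra (ZMod 2) K]

theorem exists_eq_trace_mul (l : K →ₗ[ZMod 2] ZMod 2) :
    ∃ α : K, ∀ x, l x = Algebra.trace (ZMod 2) K (α * x) := by
  have hnd := traceForm_nondegenerate (ZMod 2) K
  obtain ⟨α, hα⟩ := ((Algebra.traceForm (ZMod 2) K).toDual hnd).surjective l
  exact ⟨α, fun x => by rw [← hα]; rfl⟩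

theorem eq_zero_of_forall_trace_mul_eq_zero {z : K}
    (hz : ∀ β : K, Algebra.trace (ZMod 2) K (β * z) = 0) : z = 0 :=
  (traceForm_nondegenerate (ZMod 2) K).1 z fun β => by
    rw [Algebra.traceForm_apply, mul_comm]; exact hz β

theorem comp_addRight_mem_code {f : K → K}
    (hf : ∀ a : K, IsLinearMap (ZMod 2) fun x => f (x + a) + f x + f a) (a : K)
    {c : K → ZMod 2} (hc : c ∈ code f) : c ∘ Equiv.addRight a ∈ code f := by
  obtain ⟨α, β, ε, rfl⟩ := hc
  obtain ⟨α', hα'⟩ := exists_eq_trace_mul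
    ((Algebra.trace (ZMod 2) K).comp
      ((LinearMap.mulLeft (ZMod 2) β).comp ((polarization f hf).flip a)))
  refine ⟨α + α', β, Algebra.trace (ZMod 2) K (α * a) + Algebra.trace (ZMod 2) K (β * f a) + ε,
    ?_⟩
  funext x
  have hx : Algebra.trace (ZMod 2) K (β * polarization f hf x a) =
    Algebra.trace (ZMod 2) K (α' * x) := hα' x
  simp only [Function.comp_apply, Equiv.coe_addRight, map_add_eq_polarization hf, mul_add, add_mul,
    map_add, hx]
  ring

/-- If `σ` maps the code of `f` to the code of `h`, it conjugates the translations into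
automorphisms of the code of `h`. -/
theorem conj_addRight_mem_autCode {f h : K → K}
    (hf : ∀ a : K, IsLinearMap (ZMod 2) fun x => f (x + a) + f x + f a) {σ : Equiv.Perm K}
    (hσ : (fun c : K → ZMod 2 => c ∘ ⇑σ) '' code f = code h) (a : K) :
    σ⁻¹ * Equiv.addRight a * σ ∈ autCode (code h) := by
  have hsub : ∀ (b : K) (c), c ∈ code h → c ∘ ⇑(σ⁻¹ * Equiv.addRight b * σ) ∈ code h := by
    intro b c hc
    rw [← hσ] at hc ⊢
    obtain ⟨d, hd, rfl⟩ := hc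
    refine ⟨d ∘ Equiv.addRight b, comp_addRight_mem_code hf b hd, ?_⟩
    funext x
    simp
  apply Set.Subset.antisymm
  · rintro _ ⟨c, hc, rfl⟩
    exact hsub a c hc
  · intro c hc
    refine ⟨_, hsub (-a) c hc, ?_⟩
    funext x
    simp

/-- The homomorphism `a ↦ σ⁻¹ ∘ (x ↦ x + a) ∘ σ` from the additive group of `K` to the
automorphism group of the code of `h`. -/
def conjTranslation {f h : K → K}
    (hf : ∀ a : K, IsLinearMap (ZMod 2) fun x => f (x + a) + f x + f a) {σ : Equiv.Perm K}
    (hσ : (fun c : K → ZMod 2 => c ∘ ⇑σ) '' code f = code h) :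
    Multiplicative K →* autCode (code h) where
  toFun a := ⟨σ⁻¹ * Equiv.addRight a.toAdd * σ, conj_addRight_mem_autCode hf hσ _⟩
  map_one' := by ext x; simp
  map_mul' a b := by
    ext x
    simp [add_comm a.toAdd, add_assoc]

theorem conjTranslation_injective {f h : K → K}
    (hf : ∀ a : K, IsLinearMap (ZMod 2) fun x => f (x + a) + f x + f a) {σ : Equiv.Perm K}
    (hσ : (fun c : K → ZMod 2 => c ∘ ⇑σ) '' code f = code h) :
    Function.Injective (conjTranslation hf hσ) := by
  intro a b hab
  have h1 : σ⁻¹ * Equiv.addRight a.toAdd * σ = σ⁻¹ * Equiv.addRight b.toAdd * σ :=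
    congrArg Subtype.val hab
  have h2 : Equiv.addRight a.toAdd = Equiv.addRight b.toAdd := by simpa using h1
  simpa using Equiv.congr_fun h2 0

/-- An affine permutation mapping the code of `f` to the code of `h` yields an EA-equivalence. -/
theorem eaEquiv_of_isAffineMap {f h : K → K}
    (hf : ∀ a : K, IsLinearMap (ZMod 2) fun x => f (x + a) + f x + f a)
    (hh : ∀ a : K, IsLinearMap (ZMod 2) fun x => h (x + a) + h x + h a) {σ : Equiv.Perm K}
    (hσ : (fun c : K → ZMod 2 => c ∘ ⇑σ) '' code f = code h) (haff : IsAffineMap σ) :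
    EAEquiv f h := by
  have h2 := two_eq_zero_of_algebra K
  have h2' : (2 : ZMod 2) = 0 := rfl
  have h0 := map_zero_of_quadratic hh
  obtain ⟨L, t, hL⟩ := id haff
  have hpol : ∀ x y, f (σ (x + y)) + f (σ x) + f (σ y) + f (σ 0) =
      polarization f hf (L x) (L y) := by
    intro x y
    simp only [hL, map_add, map_zero, zero_add, map_add_eq_polarization hf, LinearMap.add_apply]
    linear_combination (f (L x) + f (L y) + 2 * f t + polarization f hf (L x) t +
      polarization f hf (L y) t) * h2
  -- polarizing a relation between components
  have hrel : ∀ α β α' β' : K, ∀ ε ε' : ZMod 2,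
      (∀ x, Algebra.trace (ZMod 2) K (α * σ x) + Algebra.trace (ZMod 2) K (β * f (σ x)) + ε =
        Algebra.trace (ZMod 2) K (α' * x) + Algebra.trace (ZMod 2) K (β' * h x) + ε') →
      ∀ x y, Algebra.trace (ZMod 2) K (β * polarization f hf (L x) (L y)) =
        Algebra.trace (ZMod 2) K (β' * polarization h hh x y) := by
    intro α β α' β' ε ε' H x y
    have e1 := H (x + y)
    have e2 := H x
    have e3 := H y
    have e4 := H 0
    rw [← hpol, polarization_apply]
    simp only [hL, map_add, map_zero, mul_add, mul_zero, add_zero, zero_add, h0] at e1 e2 e3 e4 ⊢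
    linear_combination e1 + e2 + e3 + e4 - (Algebra.trace (ZMod 2) K (α * L x) +
      Algebra.trace (ZMod 2) K (α * L y) + 2 * Algebra.trace (ZMod 2) K (α * t) + 2 * ε - 2 * ε' -
      Algebra.trace (ZMod 2) K (α' * x) - Algebra.trace (ZMod 2) K (α' * y)) * h2'
  let X := TensorProduct.lift ((polarization f hf).compl₁₂ L L)
  let Y := TensorProduct.lift (polarization h hh)
  have htr : ∀ β β' : K, (∀ x y, Algebra.trace (ZMod 2) K (β * polarization f hf (L x) (L y)) =
      Algebra.trace (ZMod 2) K (β' * polarization h hh x y)) →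
      ∀ z, Algebra.trace (ZMod 2) K (β * X z) = Algebra.trace (ZMod 2) K (β' * Y z) := by
    intro β β' H z
    induction z with
    | zero => simp
    | tmul x y => exact H x y
    | add z w hz hw => simp only [map_add, mul_add, hz, hw]
  have hker : LinearMap.ker X = LinearMap.ker Y := by
    ext z
    simp only [LinearMap.mem_ker]
    constructor
    · intro hz
      refine eq_zero_of_forall_trace_mul_eq_zero fun β' => ?_
      have hmem : (fun x => Algebra.trace (ZMod 2) K (0 * x) +
          Algebra.trace (ZMod 2) K (β' * h x) + 0) ∈ code h := ⟨0, β', 0, rfl⟩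
      rw [← hσ] at hmem
      obtain ⟨_, ⟨α, β, ε, rfl⟩, hc⟩ := hmem
      rw [← htr β β' (hrel α β 0 β' ε 0 (congrFun hc)) z, hz, mul_zero, map_zero]
    · intro hz
      refine eq_zero_of_forall_trace_mul_eq_zero fun β => ?_
      have hmem : (fun x => Algebra.trace (ZMod 2) K (0 * x) +
          Algebra.trace (ZMod 2) K (β * f x) + 0) ∘ σ ∈ code h :=
        hσ ▸ ⟨_, ⟨0, β, 0, rfl⟩, rfl⟩
      obtain ⟨α', β', ε', hc⟩ := hmem
      rw [htr β β' (hrel 0 β α' β' 0 ε' (congrFun hc)) z, hz, mul_zero, map_zero]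
  obtain ⟨e, he⟩ := LinearMap.exists_linearEquiv_of_ker_eq hker
  refine eaEquiv_of_polarization_eq haff e fun x y => ?_
  rw [hpol, h0, add_zero]
  exact he (x ⊗ₜ[ZMod 2] y)

end Code

section SemiAffine

variable {K : Type*} [Field K] [Algebra (ZMod 2) K]

/-- The fixed points of a semilinear map `s ↦ a γ(s)` with `γ ≠ 1` number at most `√|K|`. -/
theorem card_fixed_sq_le [Finite K] {a : K} {γ : K ≃ₐ[ZMod 2] K} (hγ : γ ≠ 1) :
    {s : K | a * γ s = s}.ncard ^ 2 ≤ Nat.card K := by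
  obtain ⟨y, hy⟩ : ∃ y, γ y ≠ y := by
    by_contra! h
    exact hγ (AlgEquiv.ext h)
  rw [sq, ← Nat.card_coe_set_eq, ← Nat.card_prod]
  refine Nat.card_le_card_of_injective
    (fun p : {s : K | a * γ s = s} × {s : K | a * γ s = s} => p.1.1 + p.2.1 * y) ?_
  rintro ⟨⟨u, hu⟩, ⟨v, hv⟩⟩ ⟨⟨u', hu'⟩, ⟨v', hv'⟩⟩ h
  simp only [Set.mem_ofPred_eq] at hu hv hu' hv' h
  have hg := congrArg (fun z => a * γ z) h
  simp only [map_add, map_mul] at hg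
  have hv2 : (v - v') * (γ y - y) = 0 := by
    linear_combination hg - h - hu + hu' - γ y * hv + γ y * hv'
  have hvv : v = v' := by
    rcases mul_eq_zero.mp hv2 with h0 | h0
    · exact sub_eq_zero.mp h0
    · exact absurd (sub_eq_zero.mp h0) hy
  have huu : u = u' := by linear_combination h - y * hvv
  simp [hvv, huu]

theorem eq_of_sq_eq_one_of_isCyclic {G : Type*} [Group G] [Finite G] [IsCyclic G] {g k : G}
    (hg : g ^ 2 = 1) (hk : k ^ 2 = 1) (hg1 : g ≠ 1) (hk1 : k ≠ 1) : g = k := by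
  classical
  have := Fintype.ofFinite G
  by_contra hgk
  have hsub : ({1, g, k} : Finset G) ⊆ Finset.univ.filter fun x => x ^ 2 = 1 := by
    intro x hx
    simp only [Finset.mem_insert, Finset.mem_singleton] at hx
    rcases hx with rfl | rfl | rfl <;> simp [*]
  have h3 : ({1, g, k} : Finset G).card = 3 :=
    Finset.card_eq_three.mpr ⟨1, g, k, hg1.symm, hk1.symm, hgk, rfl⟩
  have h1 := Finset.card_le_card hsub
  have h4 := IsCyclic.card_pow_eq_one_le (α := G) (n := 2) two_pos
  omega

/-- If `|K| > 4`, every embedding of the additive group of `K` into the group of semiaffine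
permutations has image in the translations. -/
theorem exists_eq_addRight_of_injective [Finite K] (hK : 4 < Nat.card K)
    {ψ : Multiplicative K →* Equiv.Perm K} (hψ : Function.Injective ψ)
    (hmem : ∀ x, ψ x ∈ semiAffineSet K) (x : Multiplicative K) :
    ∃ t : K, ψ x = Equiv.addRight t := by
  have h2 := two_eq_zero_of_algebra K
  choose a γ t ha hψx using hmem
  have hmul : ∀ x y z, a (x * y) * γ (x * y) z + t (x * y) =
      a x * γ x (a y * γ y z + t y) + t x := by
    intro x y z
    rw [← hψx, ← hψx, ← hψx, map_mul, Equiv.Perm.mul_apply]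
  have ht : ∀ x y, t (x * y) = a x * γ x (t y) + t x := by
    intro x y
    simpa using hmul x y 0
  have ha' : ∀ x y, a (x * y) = a x * γ x (a y) := by
    intro x y
    have h1 := hmul x y 1
    simp only [map_one, mul_one, map_add] at h1
    linear_combination h1 - ht x y
  have hγ : ∀ x y, γ (x * y) = γ x * γ y := by
    intro x y
    ext z
    have h1 := hmul x y z
    simp only [map_mul, map_add] at h1
    refine mul_left_cancel₀ (ha (x * y)) ?_
    rw [AlgEquiv.mul_apply]
    linear_combination h1 - ht x y - γ x (γ y z) * ha' x y
  have hxx : ∀ x : Multiplicative K, x * x = 1 := fun x => by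
    change Multiplicative.ofAdd (x.toAdd + x.toAdd) = 1
    rw [show x.toAdd + x.toAdd = 0 by linear_combination x.toAdd * h2]
    rfl
  have hγ1 : γ 1 = 1 := by
    have := hγ 1 1
    simpa using this
  have hγ2 : ∀ x, γ x ^ 2 = 1 := fun x => by rw [sq, ← hγ, hxx, hγ1]
  have ha1 : a 1 = 1 := by
    have h1 := ha' 1 1
    rw [hγ1, mul_one] at h1
    exact (mul_eq_left₀ (ha 1)).mp h1.symm
  have hlin : ∀ x, γ x = 1 → a x = 1 := by
    intro x hx
    have h1 := ha' x x
    rw [hxx, ha1, hx, AlgEquiv.one_apply] at h1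
    have h3 : (a x - 1) ^ 2 = 0 := by linear_combination -h1 + (1 - a x) * h2
    exact sub_eq_zero.mp (pow_eq_zero_iff two_ne_zero |>.mp h3)
  have htrans : ∀ x, γ x = 1 → ψ x = Equiv.addRight (t x) := by
    intro x hx
    ext z
    simp [hψx, hx, hlin x hx]
  by_cases hx : γ x = 1
  · exact ⟨t x, htrans x hx⟩
  exfalso
  let S : Set (Multiplicative K) := {y | γ y = 1}
  have hcover : S ∪ (fun y => x * y) '' S = Set.univ := by
    refine Set.eq_univ_of_forall fun y => ?_
    by_cases hy : γ y = 1
    · exact Or.inl hy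
    · refine Or.inr ⟨x * y, ?_, ?_⟩
      · change γ (x * y) = 1
        rw [hγ, eq_of_sq_eq_one_of_isCyclic (hγ2 x) (hγ2 y) hx hy, ← sq, hγ2]
      · change x * (x * y) = y
        rw [← mul_assoc, hxx, one_mul]
  have hcard : Nat.card K ≤ 2 * S.ncard := by
    have h1 := Set.ncard_union_le S ((fun y => x * y) '' S)
    have h3 := Set.ncard_image_le (f := fun y => x * y) (Set.toFinite S)
    rw [hcover, Set.ncard_univ] at h1
    have h4 : Nat.card (Multiplicative K) = Nat.card K := rfl
    omega
  have hfix : S.ncard ≤ {s : K | a x * γ x s = s}.ncard := by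
    refine Set.ncard_le_ncard_of_injOn t (fun y hy => ?_) (fun y hy z hz hyz => hψ ?_)
      (Set.toFinite _)
    · have h1 := ht x y
      have h3 := ht y x
      rw [show γ y = 1 from hy, hlin y hy, mul_comm y x, AlgEquiv.one_apply] at h3
      change a x * γ x (t y) = t y
      linear_combination h3 - h1
    · rw [htrans y hy, htrans z hz, hyz]
  have hsq := card_fixed_sq_le (a := a x) hx
  nlinarith

theorem exists_addRight_eq_of_injective [Finite K] (hK : 4 < Nat.card K)
    {ψ : Multiplicative K →* Equiv.Perm K} (hψ : Function.Injective ψ)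
    (hmem : ∀ x, ψ x ∈ semiAffineSet K) (t : K) : ∃ x, ψ x = Equiv.addRight t := by
  choose r hr using exists_eq_addRight_of_injective hK hψ hmem
  have hinj : Function.Injective fun y : K => r (Multiplicative.ofAdd y) := fun y z hyz => by
    have := hψ ((hr _).trans ((congrArg Equiv.addRight hyz).trans (hr _).symm))
    exact Multiplicative.ofAdd.injective this
  obtain ⟨y, hy⟩ := Finite.surjective_of_injective hinj t
  exact ⟨_, (hr _).trans (congrArg Equiv.addRight hy)⟩

end SemiAffine

/-- Let `h` be a quadratic APN function whose automorphism group `Aut(C_h)` is isomorphic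
(as an abstract group) to a subgroup of `𝒢 = (K,+) : K^* : Gal(K/F₂)`.  Then every
quadratic APN function `f` that is CCZ-equivalent to `h` is EA-equivalent to `h`. -/
theorem stmt9 {K : Type*} [Field K] [Fintype K] [Algebra (ZMod 2) K]
    (n : ℕ) (hn : 1 ≤ n) (hcard : Fintype.card K = 2 ^ n)
    (h : K → K)
    (hquad : ∀ a : K, IsLinearMap (ZMod 2) fun x => h (x + a) + h x + h a)
    (hapn : IsAPN h)
    (hiso : ∃ φ : autCode (code h) →* Equiv.Perm K,
      Function.Injective φ ∧ ∀ σ, φ σ ∈ semiAffineSet K)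
    (f : K → K)
    (hfquad : ∀ a : K, IsLinearMap (ZMod 2) fun x => f (x + a) + f x + f a)
    (hfapn : IsAPN f)
    (hccz : ∃ σ : Equiv.Perm K, (fun c : K → ZMod 2 => c ∘ ⇑σ) '' code f = code h) :
    EAEquiv f h := by
  by_cases hK : Fintype.card K ≤ 4
  · exact eaEquiv_of_card_le_four hK hfquad hfapn hquad hapn
  have hK4 : 4 < Nat.card K := by rw [Nat.card_eq_fintype_card]; omega
  obtain ⟨φ, hφ, hφmem⟩ := hiso
  obtain ⟨σ, hσ⟩ := hccz
  have hone : (fun c : K → ZMod 2 => c ∘ ⇑(1 : Equiv.Perm K)) '' code h = code h :=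
    (autCode (code h)).one_mem
  refine eaEquiv_of_isAffineMap hfquad hquad hσ (isAffineMap_of_map_add fun x y => ?_)
  obtain ⟨t, ht⟩ := exists_eq_addRight_of_injective hK4
    (ψ := φ.comp (conjTranslation hquad hone)) (hφ.comp (conjTranslation_injective hquad hone))
    (fun _ => hφmem _) (Multiplicative.ofAdd y)
  obtain ⟨a, ha⟩ := exists_addRight_eq_of_injective hK4
    (ψ := φ.comp (conjTranslation hfquad hσ)) (hφ.comp (conjTranslation_injective hfquad hσ))
    (fun _ => hφmem _) t
  have hconj : (1 : Equiv.Perm K)⁻¹ * Equiv.addRight y * 1 = σ⁻¹ * Equiv.addRight a.toAdd * σ :=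
    congrArg Subtype.val (hφ (ht.trans ha.symm))
  have hadd : ∀ z, σ (z + y) = σ z + a.toAdd := by
    intro z
    have := congrArg σ (Equiv.congr_fun hconj z)
    simpa using this
  have h0 := hadd 0
  rw [zero_add] at h0
  rw [hadd, h0]
  linear_combination -σ 0 * two_eq_zero_of_algebra K
end

section
/- For c ∈ K ∖ L, let C_c denote the F_2-subspace { x ↦ Tr(β f_{c,s}(x)) : β ∈ K } of F_2^K. Then for any two elements c, d ∈ K ∖ L one has C_c = C_d; that is, the code C_c does not depend on the choice of c ∈ K ∖ L. -/
/-- The trinomial family `f_{c,s}(x) = b x^(2^s+1) + (b x^(2^s+1))^(2^k) + c x^(2^k+1)`. -/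
def fam {K : Type*} [Field K] (k s : ℕ) (b c : K) : K → K :=
  fun x => b * x ^ (2 ^ s + 1) + (b * x ^ (2 ^ s + 1)) ^ (2 ^ k) + c * x ^ (2 ^ k + 1)

/-- The absolute trace is invariant under every power of the Frobenius map. -/
theorem trace_pow_two_pow {K : Type*} [Field K] [Fintype K] [Algebra (ZMod 2) K] (k : ℕ) (x : K) :
    Algebra.trace (ZMod 2) K (x ^ 2 ^ k) = Algebra.trace (ZMod 2) K x := by
  have frobenius_trace (y : K) :
      Algebra.trace (ZMod 2) K (y ^ 2) = Algebra.trace (ZMod 2) K y := by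
    have h := Algebra.trace_eq_of_algEquiv
      (FiniteField.frobeniusAlgEquivOfAlgebraic (ZMod 2) K) y
    simpa using h
  induction k with
  | zero => simp
  | succ n ih => rw [pow_succ, pow_mul, frobenius_trace, ih]

/-- If `x ↦ x ^ 2 ^ k` is an involution that moves `c`, its fixed points have absolute trace 0. -/
theorem trace_eq_zero_of_pow_eq_self {K : Type*} [Field K] [Fintype K] [Algebra (ZMod 2) K]
    {k : ℕ} (hinv : ∀ x : K, (x ^ 2 ^ k) ^ 2 ^ k = x) {c : K} (hc : c ^ 2 ^ k ≠ c)
    {y : K} (hy : y ^ 2 ^ k = y) : Algebra.trace (ZMod 2) K y = 0 := by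
  have : CharP K 2 := charP_of_injective_algebraMap (algebraMap (ZMod 2) K).injective 2
  have hne : c + c ^ 2 ^ k ≠ 0 := fun h => hc (CharTwo.add_eq_zero.mp h).symm
  have hz : y = y * c / (c + c ^ 2 ^ k) + (y * c / (c + c ^ 2 ^ k)) ^ 2 ^ k := by
    rw [div_pow, mul_pow, add_pow_char_pow, hinv, hy, add_comm (c ^ 2 ^ k) c, ← add_div, ← mul_add,
      mul_div_cancel_right₀ _ hne]
  rw [hz, map_add, trace_pow_two_pow, CharTwo.add_self_eq_zero]

/-- Each codeword of `C_c` is a codeword of `C_d`. -/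
theorem exists_trace_mul_fam_eq {K : Type*} [Field K] [Fintype K] [Algebra (ZMod 2) K]
    {k : ℕ} (hinv : ∀ x : K, (x ^ 2 ^ k) ^ 2 ^ k = x) (s : ℕ) (b c : K) {d : K}
    (hd : d ^ 2 ^ k ≠ d) (β : K) :
    ∃ γ : K, ∀ x : K, Algebra.trace (ZMod 2) K (β * fam k s b c x) =
      Algebra.trace (ZMod 2) K (γ * fam k s b d x) := by
  have : CharP K 2 := charP_of_injective_algebraMap (algebraMap (ZMod 2) K).injective 2
  have h2 : (2 : K) = 0 := CharTwo.two_eq_zero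
  have hne : d + d ^ 2 ^ k ≠ 0 := fun h => hd (CharTwo.add_eq_zero.mp h).symm
  obtain ⟨γ, hγ⟩ : ∃ γ : K, γ = (d ^ 2 ^ k * (β + β ^ 2 ^ k) + (β * c + (β * c) ^ 2 ^ k)) /
    (d + d ^ 2 ^ k) := ⟨_, rfl⟩
  have hγ' : γ ^ 2 ^ k = (d * (β + β ^ 2 ^ k) + (β * c + (β * c) ^ 2 ^ k)) / (d + d ^ 2 ^ k) := by
    rw [hγ]
    simp only [div_pow, add_pow_char_pow, mul_pow, hinv]
    congr 1 <;> ring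
  have hfix : (β + γ) ^ 2 ^ k = β + γ := by
    rw [add_pow_char_pow, hγ', hγ]
    field_simp
    linear_combination (d * β ^ 2 ^ k - d ^ 2 ^ k * β) * h2
  have hfix' : (β * c + γ * d) ^ 2 ^ k = β * c + γ * d := by
    rw [add_pow_char_pow, mul_pow γ, hγ', hγ]
    field_simp
    linear_combination (β ^ 2 ^ k * c ^ 2 ^ k * d ^ 2 ^ k - β * c * d) * h2
  refine ⟨γ, fun x => ?_⟩
  have hT : (b * x ^ (2 ^ s + 1) + (b * x ^ (2 ^ s + 1)) ^ 2 ^ k) ^ 2 ^ k =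
      b * x ^ (2 ^ s + 1) + (b * x ^ (2 ^ s + 1)) ^ 2 ^ k := by
    rw [add_pow_char_pow, hinv, add_comm]
  have hN : (x ^ (2 ^ k + 1)) ^ 2 ^ k = x ^ (2 ^ k + 1) := by
    rw [pow_succ, mul_pow, hinv, mul_comm]
  rw [← sub_eq_zero, ← map_sub, CharTwo.sub_eq_add]
  have hsplit : β * fam k s b c x + γ * fam k s b d x =
      (β + γ) * (b * x ^ (2 ^ s + 1) + (b * x ^ (2 ^ s + 1)) ^ 2 ^ k) +
        (β * c + γ * d) * x ^ (2 ^ k + 1) := by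
    simp only [fam]
    ring
  rw [hsplit]
  refine trace_eq_zero_of_pow_eq_self hinv hd ?_
  rw [add_pow_char_pow, mul_pow (β + γ), mul_pow (β * c + γ * d), hfix, hfix', hT, hN]

/-- For `c ∈ K ∖ L` (where `L = F_{2^k}` is the index-2 subfield, i.e. `c^(2^k) ≠ c`),
the code `C_c = { x ↦ Tr(β f_{c,s}(x)) : β ∈ K }` does not depend on the choice of `c`:
for all `c, d ∈ K ∖ L`, `C_c = C_d`. -/
theorem stmt10 {K : Type*} [Field K] [Fintype K] [Algebra (ZMod 2) K]
    (k s : ℕ) (hk : Odd k) (hs : Odd s) (hks : Nat.Coprime k s)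
    (hcard : Fintype.card K = 2 ^ (2 * k))
    (b : K) (hb : ∀ x : K, x ≠ 0 → ∃ m : ℕ, x = b ^ m)
    (c d : K) (hc : c ^ (2 ^ k) ≠ c) (hd : d ^ (2 ^ k) ≠ d) :
    {w : K → ZMod 2 | ∃ β : K, w = fun x => Algebra.trace (ZMod 2) K (β * fam k s b c x)}
      = {w : K → ZMod 2 | ∃ β : K,
          w = fun x => Algebra.trace (ZMod 2) K (β * fam k s b d x)} := by
  have hinv (x : K) : (x ^ 2 ^ k) ^ 2 ^ k = x := by
    rw [← pow_mul, ← pow_add, ← two_mul, ← hcard, FiniteField.pow_card]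
  ext w
  constructor
  · rintro ⟨β, rfl⟩
    obtain ⟨γ, hγ⟩ := exists_trace_mul_fam_eq hinv s b c hd β
    exact ⟨γ, funext hγ⟩
  · rintro ⟨β, rfl⟩
    obtain ⟨γ, hγ⟩ := exists_trace_mul_fam_eq hinv s b d hc β
    exact ⟨γ, funext hγ⟩
end

section
/- Let n = 2k with k odd, and let G be the group of permutations of K of the form x ↦ a·γ(x) with a ∈ K^* and γ ∈ Gal(K/F_2) (so G = K^* : Gal(K/F_2)). Then G contains a unique cyclic subgroup of order 3(2^k − 1). -/
/-- The group `G = K^* : Gal(K/F₂)` inside `Sym(K)`, as a set of permutations: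
the maps `x ↦ a·γ(x)` with `a ∈ K^*`, `γ ∈ Gal(K/F₂)`. -/
def semiLinearSet (K : Type*) [Field K] [Algebra (ZMod 2) K] : Set (Equiv.Perm K) :=
  {π | ∃ (a : K) (γ : K ≃ₐ[ZMod 2] K), a ≠ 0 ∧ ∀ x, π x = a * γ x}

theorem mul_sq_add_three_lt {y m : ℕ} (hy : 2 ≤ y) (hm : 3 ≤ m) :
    m * y ^ 2 + 3 < 3 * y ^ m + m := by
  induction m, hm using Nat.le_induction with
  | base => nlinarith [Nat.pow_le_pow_left hy 2]
  | succ m hm ih =>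
    have h1 : y ^ 2 ≤ y ^ m := Nat.pow_le_pow_right (by lia) (by lia)
    have h2 : y ^ m * 2 ≤ y ^ m * y := Nat.mul_le_mul_left _ hy
    rw [pow_succ y m]
    nlinarith

theorem mul_two_pow_sub_one_lt {k d m : ℕ} (hk : 0 < k) (hm : Odd m) (hm1 : m ≠ 1)
    (h : d * m = 2 * k) : m * (2 ^ d - 1) < 3 * (2 ^ k - 1) := by
  obtain ⟨l, rfl⟩ : 2 ∣ d :=
    (Nat.coprime_two_left.mpr hm).dvd_of_dvd_mul_right ⟨k, h⟩
  obtain rfl : k = l * m := by nlinarith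
  have hl : l ≠ 0 := by rintro rfl; simp at hk
  have hm3 : 3 ≤ m := by obtain ⟨j, rfl⟩ := hm; lia
  have hy : 2 ≤ 2 ^ l := Nat.le_self_pow hl 2
  have key := mul_sq_add_three_lt hy hm3
  rw [mul_comm 2 l, pow_mul, pow_mul, Nat.mul_sub, Nat.mul_sub]
  have : 1 ≤ (2 ^ l) ^ m := Nat.one_le_pow _ _ (by lia)
  have : m * 1 ≤ m * (2 ^ l) ^ 2 := Nat.mul_le_mul_left _ (Nat.one_le_pow _ _ (by lia))
  lia

theorem three_mul_dvd_two_pow_sub_one {k : ℕ} (hk : Odd k) :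
    3 * (2 ^ k - 1) ∣ 2 ^ (2 * k) - 1 := by
  have h3 : 3 ∣ 2 ^ k + 1 := by simpa using hk.nat_add_dvd_pow_add_pow 2 1
  have h : 2 ^ (2 * k) - 1 = (2 ^ k + 1) * (2 ^ k - 1) := by
    rw [← Nat.sq_sub_sq, ← pow_mul, mul_comm 2 k, one_pow]
  rw [h]
  exact Nat.mul_dvd_mul_right h3 _

theorem semiLinear_pow_apply {K : Type*} [Field K] [Algebra (ZMod 2) K]
    {g : Equiv.Perm K} {a : K} {γ : K ≃ₐ[ZMod 2] K} (ha : a ≠ 0)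
    (hg : ∀ x, g x = a * γ x) (j : ℕ) :
    ∃ c : K, c ≠ 0 ∧ ∀ x, (g ^ j) x = c * (γ ^ j) x := by
  induction j with
  | zero => exact ⟨1, one_ne_zero, by simp⟩
  | succ j ih =>
    obtain ⟨c, hc, h⟩ := ih
    refine ⟨a * γ c, mul_ne_zero ha (by simpa using hc), fun x => ?_⟩
    rw [pow_succ', pow_succ', Equiv.Perm.mul_apply, h, hg, map_mul, AlgEquiv.mul_apply, mul_assoc]

/-- The order of a semilinear permutation `x ↦ a * γ x` is divisible by the order `m` of `γ`
and divides `m * (q - 1)`, where `q` is the order of the fixed field of `γ`. -/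
theorem exists_orderOf_semiLinear_dvd {K : Type*} [Field K] [Fintype K] [Algebra (ZMod 2) K]
    {n : ℕ} (hcard : Fintype.card K = 2 ^ n) {g : Equiv.Perm K} {a : K} {γ : K ≃ₐ[ZMod 2] K}
    (ha : a ≠ 0) (hg : ∀ x, g x = a * γ x) :
    ∃ d : ℕ, d * orderOf γ = n ∧ orderOf γ ∣ orderOf g ∧
      orderOf g ∣ orderOf γ * (2 ^ d - 1) := by
  classical
  have hdvd : orderOf γ ∣ orderOf g := by
    obtain ⟨c, -, h⟩ := semiLinear_pow_apply ha hg (orderOf g)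
    rw [pow_orderOf_eq_one] at h
    have hc : c = 1 := by simpa using (h 1).symm
    refine orderOf_dvd_of_pow_eq_one (AlgEquiv.ext fun x => ?_)
    simpa [hc] using (h x).symm
  obtain ⟨b, hb, h⟩ := semiLinear_pow_apply ha hg (orderOf γ)
  simp only [pow_orderOf_eq_one, AlgEquiv.one_apply] at h
  have hγb : γ b = b := by
    have h1 : g ((g ^ orderOf γ) 1) = (g ^ orderOf γ) (g 1) := by
      rw [← Equiv.Perm.mul_apply, ← Equiv.Perm.mul_apply, ← pow_succ', ← pow_succ]
    rw [h, h, hg, hg, map_mul, map_one, mul_one, mul_one, mul_comm b] at h1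
    exact mul_left_cancel₀ ha h1
  let F := IntermediateField.fixedField (Subgroup.zpowers γ)
  have hbF : b ∈ F := by
    rw [IntermediateField.mem_fixedField_iff]
    intro f hf
    have : Subgroup.zpowers γ ≤ MulAction.stabilizer (K ≃ₐ[ZMod 2] K) b := by
      rw [Subgroup.zpowers_le]
      exact hγb
    exact this hf
  have hF : Fintype.card F = 2 ^ Module.finrank (ZMod 2) F := by
    rw [Module.card_eq_pow_finrank (K := ZMod 2), ZMod.card]
  refine ⟨Module.finrank (ZMod 2) F, ?_, hdvd, ?_⟩
  · have h1 := IntermediateField.finrank_fixedField_eq_card (Subgroup.zpowers γ)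
    rw [Nat.card_zpowers] at h1
    rw [← h1, Module.finrank_mul_finrank]
    have h2 := Module.card_eq_pow_finrank (K := ZMod 2) (V := K)
    rw [ZMod.card, hcard] at h2
    exact (Nat.pow_right_injective le_rfl h2).symm
  · have hb1 : b ^ (2 ^ Module.finrank (ZMod 2) F - 1) = 1 := by
      have := FiniteField.pow_card_sub_one_eq_one (⟨b, hbF⟩ : F)
        (fun h0 => hb (congrArg Subtype.val h0))
      rw [hF] at this
      exact congrArg Subtype.val this
    have hj : ∀ (j : ℕ) (x : K), ((g ^ orderOf γ) ^ j) x = b ^ j * x := by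
      intro j
      induction j with
      | zero => simp
      | succ j ih => intro x; rw [pow_succ', Equiv.Perm.mul_apply, ih, h, pow_succ', mul_assoc]
    refine orderOf_dvd_of_pow_eq_one (Equiv.ext fun x => ?_)
    rw [pow_mul, hj, hb1, one_mul, Equiv.Perm.one_apply]

/-- Let `K = F_{2^(2k)}` with `k` odd.  The group `G = K^* : Gal(K/F₂)` contains a
unique cyclic subgroup of order `3(2^k − 1)`. -/
theorem stmt16 {K : Type*} [Field K] [Fintype K] [Algebra (ZMod 2) K]
    (k : ℕ) (hk : Odd k) (hcard : Fintype.card K = 2 ^ (2 * k)) :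
    ∃! Z : Subgroup (Equiv.Perm K),
      (Z : Set (Equiv.Perm K)) ⊆ semiLinearSet K ∧ IsCyclic Z ∧
        Nat.card Z = 3 * (2 ^ k - 1) := by
  have hk0 : 0 < k := hk.pos
  have hpow : 2 ≤ 2 ^ k := Nat.le_self_pow hk0.ne' 2
  set N := 3 * (2 ^ k - 1) with hN
  have hNpos : 0 < N := by lia
  have hNodd : Odd N := by
    refine Odd.mul (by decide) (Nat.Even.sub_odd (by lia) ?_ odd_one)
    exact (even_two).pow_of_ne_zero hk0.ne'
  let φ := MulAction.toPermHom Kˣ K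
  have hφ : Function.Injective φ := MulAction.toPerm_injective
  let T : Subgroup (Equiv.Perm K) := (powMonoidHom N : Kˣ →* Kˣ).ker.map φ
  have hTcard : Nat.card T = N := by
    rw [Subgroup.card_map_of_injective hφ, IsCyclic.card_powMonoidHom_ker, Nat.card_units,
      Nat.card_eq_fintype_card, hcard]
    exact Nat.gcd_eq_right (three_mul_dvd_two_pow_sub_one hk)
  refine ⟨T, ⟨?_, ?_, hTcard⟩, ?_⟩
  · rintro _ ⟨u, -, rfl⟩
    exact ⟨u, 1, u.ne_zero, fun x => rfl⟩
  · exact isCyclic_of_surjective _ ((powMonoidHom N : Kˣ →* Kˣ).ker.equivMapOfInjective φ hφ).surjective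
  · rintro Z ⟨hZ, hcyc, hZcard⟩
    refine Subgroup.eq_of_le_of_card_ge ?_ (by rw [hTcard, hZcard])
    obtain ⟨g, hg⟩ := IsCyclic.exists_ofOrder_eq_natCard (α := Z)
    have hgZ : Subgroup.zpowers (g : Equiv.Perm K) = Z := by
      refine Subgroup.eq_of_le_of_card_ge (by simp) ?_
      rw [Nat.card_zpowers, Subgroup.orderOf_coe, hg]
    have hgN : orderOf (g : Equiv.Perm K) = N := by rw [Subgroup.orderOf_coe, hg, hZcard]
    obtain ⟨a, γ, ha, hga⟩ := hZ g.2
    obtain ⟨d, hd, hdvd, hle⟩ := exists_orderOf_semiLinear_dvd hcard ha hga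
    rw [hgN] at hdvd hle
    have hγ : orderOf γ = 1 := by
      by_contra hne
      have hlt := mul_two_pow_sub_one_lt hk0 (hNodd.of_dvd_nat hdvd) hne hd
      have hd0 : d ≠ 0 := by rintro rfl; lia
      have hdpow : 2 ≤ 2 ^ d := Nat.le_self_pow hd0 2
      exact hlt.not_ge (Nat.le_of_dvd (Nat.mul_pos (orderOf_pos γ) (by lia)) hle)
    rw [orderOf_eq_one_iff] at hγ
    have hgφ : φ (Units.mk0 a ha) = g := by
      ext x
      rw [hga, hγ]
      rfl
    rw [← hgZ, Subgroup.zpowers_le]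
    refine ⟨Units.mk0 a ha, ?_, hgφ⟩
    change Units.mk0 a ha ^ N = 1
    apply hφ
    rw [map_pow, hgφ, ← hgN, pow_orderOf_eq_one, map_one]
end
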